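/- arXiv:2411.06610 — 5 statements merged into one kernel-verified Lean document; each statement's English description precedes it below -/
import Mathlib

section
/- Let t ≥ 1 be an integer and let (η_j)_{j≥t} be integers such that the Euler product A(s) = ∏_p (1 + Σ_{j≥t} η_j p^{−js}) converges absolutely for Re s > 1, i.e. Σ_p Σ_{j≥t} |η_j| p^{−jσ} < ∞ for every σ > 1. Then there exists a sequence of integers (η'_j)_{j≥t+1} such that: (i) for all s with Re s > 1, A(s) = ζ(ts)^{η_t} · ∏_p (1 + Σ_{j≥t+1} η'_j p^{−js}); (ii) η'_j = η_j for t+1 ≤ j ≤ 2t−1, and η'_{2t} = η_{2t} − (η_t² + η_t)/2; (iii) |η'_j| ≤ (2j|η_t|)^{2|η_t|} · max_{n≤j} |η_n| for all j ≥ t+1 (with the convention 0^0 = 1, so the bound reads max_{n≤j}|η_n| when η_t = 0). -/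
open Complex

open PowerSeries in
/-- The unit `1 - X ^ t` of `ℤ⟦X⟧`, with inverse `∑ X ^ (t * k)`. -/
noncomputable def oneSubXPowUnit (t : ℕ) (ht : 1 ≤ t) : ℤ⟦X⟧ˣ :=
  have h : (1 - X ^ t : ℤ⟦X⟧) * mk (fun n => if t ∣ n then 1 else 0) = 1 := by
    ext n
    rw [sub_mul, one_mul, map_sub, coeff_X_pow_mul', coeff_one, coeff_mk]
    by_cases hn : t ≤ n
    · obtain ⟨k, rfl⟩ := Nat.exists_eq_add_of_le hn
      rw [if_neg (by omega : t + k ≠ 0)]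
      simp
    · have h1 : t ∣ n ↔ n = 0 :=
        ⟨fun h => Nat.eq_zero_of_dvd_of_lt h (by omega), fun h => h ▸ dvd_zero t⟩
      simp [hn, h1]
  ⟨1 - X ^ t, mk (fun n => if t ∣ n then 1 else 0), h, by rw [mul_comm, h]⟩

/-- The integer powers of `1 - y`, expanded to second order in `y`. -/
lemma exists_zpow_eq_of_val_eq_one_sub {R : Type*} [CommRing R] (u : Rˣ) (y : R)
    (hu : (u : R) = 1 - y) (e : ℤ) :
    ∃ g : R, ((u ^ e : Rˣ) : R)
      = 1 - (e : R) * y + ((e * (e - 1) / 2 : ℤ) : R) * y ^ 2 + y ^ 3 * g := by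
  have hc : ∀ e : ℤ, (e + 1) * (e + 1 - 1) / 2 = e * (e - 1) / 2 + e := fun e => by
    rw [← Int.add_mul_ediv_right _ _ (by norm_num : (2 : ℤ) ≠ 0)]
    ring_nf
  induction e using Int.induction_on with
  | zero => exact ⟨0, by simp⟩
  | succ n ih =>
    obtain ⟨g, hg⟩ := ih
    refine ⟨g * (1 - y) - (((n : ℤ) * (n - 1) / 2 : ℤ) : R), ?_⟩
    rw [zpow_add_one, Units.val_mul, hg, hu, hc]
    push_cast
    ring
  | pred n ih =>
    obtain ⟨g, hg⟩ := ih
    have h := hc (-(n : ℤ) - 1)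
    rw [sub_add_cancel] at h
    rw [h] at hg
    generalize (-(n : ℤ) - 1) * (-(n : ℤ) - 1 - 1) / 2 = c at hg ⊢
    refine ⟨((u⁻¹ : Rˣ) : R) * (g + c), ?_⟩
    have h1 : (u : R) * ((u⁻¹ : Rˣ) : R) = 1 := u.mul_inv
    rw [hu] at h1
    rw [zpow_sub_one, Units.val_mul, hg]
    push_cast
    linear_combination (1 + (n + 1) * y + c * y ^ 2) * h1

open PowerSeries in
/-- An integer power of `1 - X ^ t` is a natural power of a series with coefficients at most `1`
in absolute value. -/
lemma exists_oneSubXPowUnit_zpow_eq (t : ℕ) (ht : 1 ≤ t) (e : ℤ) :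
    ∃ g : ℤ⟦X⟧, (∀ n, (coeff n g).natAbs ≤ 1) ∧
      ((oneSubXPowUnit t ht ^ e : ℤ⟦X⟧ˣ) : ℤ⟦X⟧) = g ^ e.natAbs := by
  rcases Int.natAbs_eq e with h | h
  · refine ⟨1 - X ^ t, fun n => ?_, ?_⟩
    · rw [map_sub, coeff_one, coeff_X_pow]
      split_ifs <;> simp
    · rw [h, zpow_natCast, Int.natAbs_natCast, Units.val_pow_eq_pow_val]
      rfl
  · refine ⟨mk (fun n => if t ∣ n then 1 else 0), fun n => ?_, ?_⟩
    · rw [coeff_mk]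
      split_ifs <;> simp
    · rw [h, zpow_neg, zpow_natCast, Int.natAbs_neg, Int.natAbs_natCast, ← inv_pow,
        Units.val_pow_eq_pow_val]
      rfl

open PowerSeries in
lemma natAbs_coeff_mul_pow_le {f g : ℤ⟦X⟧} {j M : ℕ} (hg : ∀ n, (coeff n g).natAbs ≤ 1)
    (hf : ∀ n ≤ j, (coeff n f).natAbs ≤ M) (a : ℕ) :
    ∀ n ≤ j, (coeff n (f * g ^ a)).natAbs ≤ (j + 1) ^ a * M := by
  induction a with
  | zero => simpa using hf
  | succ a ih =>
    intro n hn
    rw [pow_succ, ← mul_assoc, coeff_mul]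
    calc (∑ p ∈ Finset.HasAntidiagonal.antidiagonal n, coeff p.1 (f * g ^ a) * coeff p.2 g).natAbs
        ≤ ∑ p ∈ Finset.HasAntidiagonal.antidiagonal n, (coeff p.1 (f * g ^ a) * coeff p.2 g).natAbs :=
          Int.natAbs_sum_le _ _
      _ ≤ ∑ _p ∈ Finset.HasAntidiagonal.antidiagonal n, (j + 1) ^ a * M := by
          refine Finset.sum_le_sum fun p hp => ?_
          rw [Int.natAbs_mul]
          have hpn := Finset.HasAntidiagonal.mem_antidiagonal.mp hp
          have h1 := ih p.1 (by omega)
          simpa using Nat.mul_le_mul h1 (hg p.2)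
      _ = (n + 1) * ((j + 1) ^ a * M) := by simp
      _ ≤ (j + 1) * ((j + 1) ^ a * M) := by gcongr
      _ = (j + 1) ^ (a + 1) * M := by ring

/-- `f` converges absolutely at `x`, with value `a`. -/
def AbsHasEval (f : PowerSeries ℤ) (x a : ℂ) : Prop :=
  Summable (fun n => ‖((PowerSeries.coeff n f : ℤ) : ℂ) * x ^ n‖) ∧
    ∑' n, ((PowerSeries.coeff n f : ℤ) : ℂ) * x ^ n = a

namespace AbsHasEval

open PowerSeries

variable {f g : ℤ⟦X⟧} {x a b : ℂ}

lemma mul (hf : AbsHasEval f x a) (hg : AbsHasEval g x b) : AbsHasEval (f * g) x (a * b) := by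
  have h : ∀ n, ((coeff n (f * g) : ℤ) : ℂ) * x ^ n = ∑ p ∈ Finset.HasAntidiagonal.antidiagonal n,
      (((coeff p.1 f : ℤ) : ℂ) * x ^ p.1) * (((coeff p.2 g : ℤ) : ℂ) * x ^ p.2) := fun n => by
    rw [coeff_mul]
    push_cast
    rw [Finset.sum_mul]
    refine Finset.sum_congr rfl fun p hp => ?_
    rw [← Finset.HasAntidiagonal.mem_antidiagonal.mp hp]
    ring
  obtain ⟨hf, rfl⟩ := hf
  obtain ⟨hg, rfl⟩ := hg
  refine ⟨?_, ?_⟩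
  · simpa only [h] using summable_norm_sum_mul_antidiagonal_of_summable_norm hf hg
  · simpa only [h] using (tsum_mul_tsum_eq_tsum_sum_antidiagonal_of_summable_norm hf hg).symm

lemma one : AbsHasEval 1 x 1 := by
  have h : ∀ n, n ≠ 0 → ((coeff n (1 : ℤ⟦X⟧) : ℤ) : ℂ) * x ^ n = 0 := fun n hn => by
    simp [coeff_one, hn]
  refine ⟨summable_of_ne_finset_zero (s := {0}) fun n hn => ?_, ?_⟩
  · rw [h n (by simpa using hn), norm_zero]
  · rw [tsum_eq_single 0 h]
    simp

lemma pow (hf : AbsHasEval f x a) (n : ℕ) : AbsHasEval (f ^ n) x (a ^ n) := by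
  induction n with
  | zero => simpa using one
  | succ n ih => simpa only [pow_succ] using ih.mul hf

lemma of_natAbs_coeff_le_one (hf : ∀ n, (coeff n f).natAbs ≤ 1) (hx : ‖x‖ < 1) :
    AbsHasEval f x (∑' n, ((coeff n f : ℤ) : ℂ) * x ^ n) := by
  refine ⟨.of_nonneg_of_le (fun _ => norm_nonneg _) (fun n => ?_)
    (summable_geometric_of_lt_one (norm_nonneg x) hx), rfl⟩
  rw [norm_mul, norm_pow, Complex.norm_intCast, ← Int.cast_abs, Int.abs_eq_natAbs]
  have : (((coeff n f).natAbs : ℤ) : ℝ) ≤ 1 := by exact_mod_cast hf n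
  exact mul_le_of_le_one_left (by positivity) this

lemma one_sub_X_pow (t : ℕ) : AbsHasEval (1 - X ^ t) x (1 - x ^ t) := by
  have h : ∀ n, ((coeff n (1 - X ^ t : ℤ⟦X⟧) : ℤ) : ℂ) * x ^ n
      = (if n = 0 then 1 else 0) - (if n = t then x ^ t else 0) := fun n => by
    rw [map_sub, coeff_one, coeff_X_pow]
    split_ifs <;> simp_all
  have hs1 := (hasSum_ite_eq 0 (1 : ℂ))
  have hs2 := (hasSum_ite_eq t (x ^ t))
  simp only [AbsHasEval, h]
  exact ⟨(hs1.sub hs2).summable.norm, (hs1.sub hs2).tsum_eq⟩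

lemma oneSubXPowUnit_zpow {t : ℕ} (ht : 1 ≤ t) (hx : ‖x‖ < 1) (e : ℤ) :
    AbsHasEval ((oneSubXPowUnit t ht ^ e : ℤ⟦X⟧ˣ) : ℤ⟦X⟧) x ((1 - x ^ t) ^ e) := by
  have hu : AbsHasEval (oneSubXPowUnit t ht : ℤ⟦X⟧) x (1 - x ^ t) := one_sub_X_pow t
  rcases Int.natAbs_eq e with h | h
  · rw [h, zpow_natCast, zpow_natCast, Units.val_pow_eq_pow_val]
    exact hu.pow _
  · obtain ⟨g, hg, hgu⟩ := exists_oneSubXPowUnit_zpow_eq t ht (-1)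
    rw [zpow_neg_one, Int.natAbs_neg, Int.natAbs_one, pow_one] at hgu
    have hv := of_natAbs_coeff_le_one hg hx
    have h1 := hu.mul hv
    rw [← hgu, Units.mul_inv] at h1
    rw [← hgu, eq_inv_of_mul_eq_one_right (h1.2.symm.trans one.2)] at hv
    rw [h, zpow_neg, zpow_neg, zpow_natCast, zpow_natCast, ← inv_pow, ← inv_pow,
      Units.val_pow_eq_pow_val]
    exact hv.pow _

/-- The value of a series `1 + O(X ^ m)`. -/
lemma one_add_tsum {m : ℕ} (hf : AbsHasEval f x a) (hm : 1 ≤ m) (h0 : coeff 0 f = 1)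
    (h : ∀ n, n ≠ 0 → n < m → coeff n f = 0) :
    1 + ∑' j : ℕ, ((coeff (j + m) f : ℤ) : ℂ) * x ^ (j + m) = a := by
  rw [← hf.2, ← hf.1.of_norm.sum_add_tsum_nat_add m,
    Finset.sum_eq_single_of_mem 0 (Finset.mem_range.mpr hm) fun n hn hn0 => by
      rw [h n hn0 (Finset.mem_range.mp hn)]; simp]
  simp [h0]

end AbsHasEval

lemma HasProd.zpow_of_ne_zero {ι : Type*} {f : ι → ℂ} {a : ℂ} (hf : HasProd f a) (ha : a ≠ 0)
    (e : ℤ) : HasProd (fun i => f i ^ e) (a ^ e) := by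
  have h := Filter.Tendsto.zpow₀ hf e (.inl ha)
  simpa only [HasProd, Finset.prod_zpow] using h

/-- The local factor `1 + ∑_{j ≥ t} η_j X ^ j`. -/
noncomputable def localFactor (t : ℕ) (η : ℕ → ℤ) : PowerSeries ℤ :=
  PowerSeries.mk fun n => if n = 0 then 1 else if n < t then 0 else η n

lemma coeff_localFactor_of_le {t n : ℕ} (ht : 1 ≤ t) (η : ℕ → ℤ) (hn : t ≤ n) :
    PowerSeries.coeff n (localFactor t η) = η n := by
  rw [localFactor, PowerSeries.coeff_mk, if_neg (by omega), if_neg (by omega)]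

lemma coeff_zero_localFactor (t : ℕ) (η : ℕ → ℤ) :
    PowerSeries.coeff 0 (localFactor t η) = 1 := by
  simp [localFactor]

lemma coeff_localFactor_of_lt {t n : ℕ} (η : ℕ → ℤ) (h0 : n ≠ 0) (hn : n < t) :
    PowerSeries.coeff n (localFactor t η) = 0 := by
  simp [localFactor, h0, hn]

/-- The local factor `(1 + ∑_{j ≥ t} η_j X ^ j) (1 - X ^ t) ^ η_t`. -/
noncomputable def reducedFactor (t : ℕ) (ht : 1 ≤ t) (η : ℕ → ℤ) : PowerSeries ℤ :=
  localFactor t η * ((oneSubXPowUnit t ht ^ η t : (PowerSeries ℤ)ˣ) : PowerSeries ℤ)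

open PowerSeries in
lemma coeff_reducedFactor {t n : ℕ} (ht : 1 ≤ t) (η : ℕ → ℤ) (hn : n ≤ 2 * t) :
    coeff n (reducedFactor t ht η) = coeff n (localFactor t η)
      - η t * (if t ≤ n then coeff (n - t) (localFactor t η) else 0)
      + if n = 2 * t then η t * (η t - 1) / 2 else 0 := by
  obtain ⟨g, hg⟩ := exists_zpow_eq_of_val_eq_one_sub (oneSubXPowUnit t ht) (X ^ t) rfl (η t)
  generalize η t * (η t - 1) / 2 = c at hg ⊢
  have h : reducedFactor t ht η = localFactor t η - C (η t) * (X ^ t * localFactor t η)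
      + C c * (X ^ (2 * t) * localFactor t η) + X ^ (3 * t) * (g * localFactor t η) := by
    rw [reducedFactor, hg, eq_intCast, eq_intCast]
    ring
  rw [h, map_add, map_add, map_sub, coeff_C_mul, coeff_C_mul, coeff_X_pow_mul', coeff_X_pow_mul',
    coeff_X_pow_mul', if_neg (by omega : ¬ 3 * t ≤ n), add_zero]
  by_cases h2 : n = 2 * t
  · simp [h2, coeff_zero_localFactor]
  · rw [if_neg (by omega : ¬ 2 * t ≤ n), if_neg h2, mul_zero]

lemma coeff_zero_reducedFactor {t : ℕ} (ht : 1 ≤ t) (η : ℕ → ℤ) :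
    PowerSeries.coeff 0 (reducedFactor t ht η) = 1 := by
  rw [coeff_reducedFactor ht η (by omega), coeff_zero_localFactor, if_neg (by omega),
    if_neg (by omega)]
  simp

lemma coeff_reducedFactor_of_le {t n : ℕ} (ht : 1 ≤ t) (η : ℕ → ℤ) (h0 : n ≠ 0) (hn : n ≤ t) :
    PowerSeries.coeff n (reducedFactor t ht η) = 0 := by
  rw [coeff_reducedFactor ht η (by omega), if_neg (by omega : n ≠ 2 * t)]
  rcases hn.eq_or_lt with rfl | hn
  · simp [coeff_localFactor_of_le ht η le_rfl, coeff_zero_localFactor]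
  · simp [coeff_localFactor_of_lt η h0 hn, hn]

lemma coeff_reducedFactor_of_lt_two_mul {t n : ℕ} (ht : 1 ≤ t) (η : ℕ → ℤ) (htn : t < n)
    (hn : n < 2 * t) : PowerSeries.coeff n (reducedFactor t ht η) = η n := by
  rw [coeff_reducedFactor ht η hn.le, coeff_localFactor_of_le ht η htn.le,
    coeff_localFactor_of_lt η (by omega : n - t ≠ 0) (by omega), if_neg hn.ne]
  simp

lemma coeff_two_mul_reducedFactor {t : ℕ} (ht : 1 ≤ t) (η : ℕ → ℤ) :
    PowerSeries.coeff (2 * t) (reducedFactor t ht η)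
      = η (2 * t) - (η t ^ 2 + η t) / 2 := by
  rw [coeff_reducedFactor ht η le_rfl, coeff_localFactor_of_le ht η (by omega), if_pos (by omega),
    if_pos rfl, show 2 * t - t = t by omega, coeff_localFactor_of_le ht η le_rfl]
  have h : η t ^ 2 + η t = η t * (η t - 1) + η t * 2 := by ring
  have h2 : 2 * (η t * (η t - 1) / 2) = η t * (η t - 1) :=
    Int.mul_ediv_cancel' (Int.even_mul_pred_self (η t)).two_dvd
  rw [h, Int.add_mul_ediv_right _ _ (by norm_num : (2 : ℤ) ≠ 0)]
  linear_combination h2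

lemma natAbs_coeff_reducedFactor_le {t j : ℕ} (ht : 1 ≤ t) (η : ℕ → ℤ) (hj : t + 1 ≤ j) :
    (PowerSeries.coeff j (reducedFactor t ht η)).natAbs
      ≤ (2 * j * (η t).natAbs) ^ (2 * (η t).natAbs) *
        (Finset.range (j + 1)).sup (fun n => (η n).natAbs) := by
  set M := (Finset.range (j + 1)).sup (fun n => (η n).natAbs)
  have hM : ∀ n ≤ j, (η n).natAbs ≤ M := fun n hn =>
    Finset.le_sup (f := fun n => (η n).natAbs) (Finset.mem_range.mpr (by omega))
  by_cases he : η t = 0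
  · have h := hM j le_rfl
    simpa [reducedFactor, he, coeff_localFactor_of_le ht η (by omega : t ≤ j)] using h
  have ha : 1 ≤ (η t).natAbs := Int.natAbs_pos.mpr he
  obtain ⟨g, hg, hgu⟩ := exists_oneSubXPowUnit_zpow_eq t ht (η t)
  have hf : ∀ n ≤ j, (PowerSeries.coeff n (localFactor t η)).natAbs ≤ M := fun n hn => by
    rw [localFactor, PowerSeries.coeff_mk]
    split_ifs
    · simpa using ha.trans (hM t (by omega))
    · simp
    · exact hM n hn
  rw [reducedFactor, hgu]
  refine (natAbs_coeff_mul_pow_le hg hf _ j le_rfl).trans (Nat.mul_le_mul_right M ?_)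
  rw [pow_mul]
  refine Nat.pow_le_pow_left ?_ _
  nlinarith [Nat.mul_le_mul (by omega : 1 ≤ j) ha, Nat.mul_le_mul_left j ha]

lemma natCast_cpow_neg_natCast_mul (p n : ℕ) (s : ℂ) :
    (p : ℂ) ^ (-(n : ℂ) * s) = ((p : ℂ) ^ (-s)) ^ n := by
  rw [← Complex.cpow_nat_mul]
  ring_nf

/-- one-step zeta-factorization of an Euler product.
If `t ≥ 1` and `(η_j)_{j ≥ t}` are integers such that the Euler product
`A(s) = ∏_p (1 + Σ_{j ≥ t} η_j p^{-js})` converges absolutely for `Re s > 1`,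
then there are integers `η'_j` (for `j ≥ t+1`) with
`A(s) = ζ(ts)^{η_t} ∏_p (1 + Σ_{j ≥ t+1} η'_j p^{-js})` for `Re s > 1`,
`η'_j = η_j` for `t+1 ≤ j ≤ 2t-1`, `η'_{2t} = η_{2t} - (η_t² + η_t)/2`, and
`|η'_j| ≤ (2j|η_t|)^{2|η_t|} · max_{n ≤ j} |η_n|` for all `j ≥ t+1`. -/
theorem stmt_0 (t : ℕ) (ht : 1 ≤ t) (η : ℕ → ℤ)
    (habs : ∀ σ : ℝ, 1 < σ →
      Summable (fun pj : Nat.Primes × ℕ =>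
        (|η (pj.2 + t)| : ℝ) * ((pj.1 : ℕ) : ℝ) ^ (-(((pj.2 + t : ℕ) : ℝ)) * σ))) :
    ∃ η' : ℕ → ℤ,
      (∀ s : ℂ, 1 < s.re →
        (∏' p : Nat.Primes,
            (1 + ∑' j : ℕ, (η (j + t) : ℂ) * ((p : ℕ) : ℂ) ^ (-(((j + t : ℕ) : ℂ)) * s)))
          = riemannZeta ((t : ℂ) * s) ^ (η t) *
            ∏' p : Nat.Primes,
              (1 + ∑' j : ℕ,
                (η' (j + (t + 1)) : ℂ) * ((p : ℕ) : ℂ) ^ (-(((j + (t + 1) : ℕ) : ℂ)) * s))) ∧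
      (∀ j : ℕ, t + 1 ≤ j → j ≤ 2 * t - 1 → η' j = η j) ∧
      (η' (2 * t) = η (2 * t) - (η t ^ 2 + η t) / 2) ∧
      (∀ j : ℕ, t + 1 ≤ j →
        (η' j).natAbs ≤ (2 * j * (η t).natAbs) ^ (2 * (η t).natAbs) *
          (Finset.range (j + 1)).sup (fun n => (η n).natAbs)) := by
  refine ⟨fun n => PowerSeries.coeff n (reducedFactor t ht η), fun s hs => ?_, fun j h1 h2 =>
    coeff_reducedFactor_of_lt_two_mul ht η (by omega) (by omega),
    coeff_two_mul_reducedFactor ht η, fun j hj => natAbs_coeff_reducedFactor_le ht η hj⟩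
  have hnorm : ∀ (p : Nat.Primes) (j : ℕ),
      ‖(η (j + t) : ℂ) * ((p : ℕ) : ℂ) ^ (-(((j + t : ℕ) : ℂ)) * s)‖
        = (|η (j + t)| : ℝ) * ((p : ℕ) : ℝ) ^ (-(((j + t : ℕ) : ℝ)) * s.re) := fun p j => by
    rw [norm_mul, Complex.norm_intCast, Complex.norm_natCast_cpow_of_pos p.2.pos]
    simp
  have hsum := habs s.re hs
  have hsum_p : ∀ p : Nat.Primes,
      Summable fun j : ℕ => ‖(η (j + t) : ℂ) * ((p : ℕ) : ℂ) ^ (-(((j + t : ℕ) : ℂ)) * s)‖ :=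
    fun p => by simpa only [hnorm] using hsum.prod_factor p
  have hA : Multipliable fun p : Nat.Primes =>
      1 + ∑' j : ℕ, (η (j + t) : ℂ) * ((p : ℕ) : ℂ) ^ (-(((j + t : ℕ) : ℂ)) * s) := by
    refine multipliable_one_add_of_summable (.of_nonneg_of_le (fun _ => norm_nonneg _)
      (fun p => norm_tsum_le_tsum_norm (hsum_p p)) ?_)
    simpa only [hnorm] using hsum.prod
  have hts : 1 < ((t : ℂ) * s).re := by
    have : (1 : ℝ) ≤ t := by exact_mod_cast ht
    simp only [Complex.mul_re, Complex.natCast_re, Complex.natCast_im, zero_mul, sub_zero]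
    nlinarith
  have hζ := riemannZeta_ne_zero_of_one_lt_re hts
  have hprod := hA.hasProd.mul
    ((riemannZeta_eulerProduct_hasProd hts).zpow_of_ne_zero hζ (-η t))
  have hfactor : ∀ p : Nat.Primes,
      1 + ∑' j : ℕ, ((PowerSeries.coeff (j + (t + 1)) (reducedFactor t ht η) : ℤ) : ℂ) *
          ((p : ℕ) : ℂ) ^ (-(((j + (t + 1) : ℕ) : ℂ)) * s)
        = (1 + ∑' j : ℕ, (η (j + t) : ℂ) * ((p : ℕ) : ℂ) ^ (-(((j + t : ℕ) : ℂ)) * s)) *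
          ((1 - ((p : ℕ) : ℂ) ^ (-((t : ℂ) * s)))⁻¹) ^ (-η t) := fun p => by
    have hp := hsum_p p
    simp only [← neg_mul, natCast_cpow_neg_natCast_mul] at hp ⊢
    have hx : ‖((p : ℕ) : ℂ) ^ (-s)‖ < 1 := by
      rw [Complex.norm_natCast_cpow_of_pos p.2.pos]
      exact Real.rpow_lt_one_of_one_lt_of_neg (by exact_mod_cast p.2.one_lt)
        (by rw [Complex.neg_re]; linarith)
    generalize ((p : ℕ) : ℂ) ^ (-s) = x at hp hx ⊢
    have hL : AbsHasEval (localFactor t η) x _ :=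
      ⟨(summable_nat_add_iff t).mp (by
        simpa only [coeff_localFactor_of_le ht η (Nat.le_add_left t _)] using hp), rfl⟩
    have hL' := hL.one_add_tsum ht (coeff_zero_localFactor t η)
      fun n h0 hn => coeff_localFactor_of_lt η h0 hn
    simp only [coeff_localFactor_of_le ht η (Nat.le_add_left t _)] at hL'
    rw [hL', inv_zpow, zpow_neg, inv_inv]
    exact (hL.mul (.oneSubXPowUnit_zpow ht hx (η t))).one_add_tsum (by omega)
      (coeff_zero_reducedFactor ht η)
      fun n h0 hn => coeff_reducedFactor_of_le ht η h0 (by omega)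
  rw [(hprod.congr_fun hfactor).tprod_eq, zpow_neg, mul_left_comm,
    mul_inv_cancel₀ (zpow_ne_zero _ hζ), mul_one]
end

section
/- Let n ≥ 0 be an integer and let (η_j)_{j≥n+1} be complex numbers for which there exist constants A, B > 0 with |η_j| ≤ (A j)^B for all j ≥ n+1. Then for every s with Re s > 1/(n+1) the series Σ_{j≥n+1} η_j p^{−js} converges absolutely for each prime p, one has Σ_p |Σ_{j≥n+1} η_j p^{−js}| < ∞, and the Euler product U_n(s) = ∏_p (1 + Σ_{j≥n+1} η_j p^{−js}) converges and defines an analytic function on the half-plane {s : Re s > 1/(n+1)}. -/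
open Complex

/-- A shifted real power times a geometric sequence of ratio less than one is summable. -/
lemma summable_mul_add_rpow_mul_geometric {A : ℝ} (hA : 0 ≤ A) (B : ℝ) {m : ℕ} (hm : 0 < m)
    {r : ℝ} (hr0 : 0 < r) (hr1 : r < 1) :
    Summable fun j : ℕ => (A * ((j + m : ℕ) : ℝ)) ^ B * r ^ j := by
  have h : Summable fun j : ℕ => ((j + m : ℕ) : ℝ) ^ ⌈B⌉₊ * r ^ (j + m) :=
    (summable_nat_add_iff (f := fun j : ℕ => (j : ℝ) ^ ⌈B⌉₊ * r ^ j) m).2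
      (summable_pow_mul_geometric_of_norm_lt_one _
        (by rwa [Real.norm_of_nonneg hr0.le]))
  refine Summable.of_nonneg_of_le (fun j => by positivity) (fun j => ?_)
    (h.mul_left (A ^ B / r ^ m))
  have h1 : (1 : ℝ) ≤ ((j + m : ℕ) : ℝ) := by exact_mod_cast (by omega : 1 ≤ j + m)
  calc (A * ((j + m : ℕ) : ℝ)) ^ B * r ^ j
      = A ^ B * ((j + m : ℕ) : ℝ) ^ B * r ^ j := by
        rw [Real.mul_rpow hA (Nat.cast_nonneg _)]
    _ ≤ A ^ B * ((j + m : ℕ) : ℝ) ^ (⌈B⌉₊ : ℝ) * r ^ j := by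
        gcongr
        exact Nat.le_ceil B
    _ = A ^ B / r ^ m * (((j + m : ℕ) : ℝ) ^ ⌈B⌉₊ * r ^ (j + m)) := by
        rw [Real.rpow_natCast, pow_add]
        field_simp

/-- On a half-plane `σ ≤ Re s` with `0 ≤ σ`, the terms `p ^ (-(j + m) s)` decay geometrically
in `j`, uniformly in `p ≥ 2`. -/
lemma norm_natCast_cpow_neg_add_mul_le {p : ℕ} (hp : 2 ≤ p) (j m : ℕ) {σ : ℝ} (hσ : 0 ≤ σ)
    {s : ℂ} (hs : σ ≤ s.re) :
    ‖(p : ℂ) ^ (-((j + m : ℕ) : ℂ) * s)‖ ≤ ((2 : ℝ) ^ (-σ)) ^ j * (p : ℝ) ^ (-(m * σ)) := by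
  have hp1 : (1 : ℝ) ≤ p := by exact_mod_cast (by omega : 1 ≤ p)
  have hp2 : (2 : ℝ) ≤ p := by exact_mod_cast hp
  have hre : (-((j + m : ℕ) : ℂ) * s).re = -(((j + m : ℕ) : ℝ) * s.re) := by
    rw [neg_mul, neg_re, ← ofReal_natCast, re_ofReal_mul]
  rw [norm_natCast_cpow_of_pos (by omega), hre]
  calc (p : ℝ) ^ (-(((j + m : ℕ) : ℝ) * s.re))
      ≤ (p : ℝ) ^ (-(((j + m : ℕ) : ℝ) * σ)) := by gcongr
    _ = ((p : ℝ) ^ (-σ)) ^ j * (p : ℝ) ^ (-(m * σ)) := by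
        rw [← Real.rpow_mul_natCast (by positivity), ← Real.rpow_add (by positivity)]
        push_cast
        ring_nf
    _ ≤ ((2 : ℝ) ^ (-σ)) ^ j * (p : ℝ) ^ (-(m * σ)) := by
        gcongr ?_ ^ j * _
        exact Real.rpow_le_rpow_of_nonpos (by norm_num) hp2 (by linarith)

/-- If `n ≥ 0` and `(η_j)_{j ≥ n+1}` are complex numbers with
`|η_j| ≤ (Aj)^B` for some constants `A, B > 0`, then for every `s` with
`Re s > 1/(n+1)` the series `Σ_{j ≥ n+1} η_j p^{-js}` converges absolutely for
each prime `p`, one has `Σ_p |Σ_{j ≥ n+1} η_j p^{-js}| < ∞`, the Euler product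
`U_n(s) = ∏_p (1 + Σ_{j ≥ n+1} η_j p^{-js})` converges, and `U_n` is analytic
on the half-plane `{s : Re s > 1/(n+1)}`. -/
theorem stmt_1 (n : ℕ) (η : ℕ → ℂ) (A B : ℝ) (hA : 0 < A) (hB : 0 < B)
    (hη : ∀ j : ℕ, n + 1 ≤ j → ‖η j‖ ≤ (A * (j : ℝ)) ^ B) :
    (∀ s : ℂ, 1 / ((n : ℝ) + 1) < s.re →
      (∀ p : Nat.Primes, Summable (fun j : ℕ =>
        ‖η (j + (n + 1)) * ((p : ℕ) : ℂ) ^ (-(((j + (n + 1) : ℕ) : ℂ)) * s)‖)) ∧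
      Summable (fun p : Nat.Primes =>
        ‖∑' j : ℕ, η (j + (n + 1)) * ((p : ℕ) : ℂ) ^ (-(((j + (n + 1) : ℕ) : ℂ)) * s)‖) ∧
      Multipliable (fun p : Nat.Primes =>
        1 + ∑' j : ℕ, η (j + (n + 1)) * ((p : ℕ) : ℂ) ^ (-(((j + (n + 1) : ℕ) : ℂ)) * s))) ∧
    DifferentiableOn ℂ
      (fun s : ℂ => ∏' p : Nat.Primes,
        (1 + ∑' j : ℕ, η (j + (n + 1)) * ((p : ℕ) : ℂ) ^ (-(((j + (n + 1) : ℕ) : ℂ)) * s)))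
      {s : ℂ | 1 / ((n : ℝ) + 1) < s.re} := by
  have hn : (0 : ℝ) < (n : ℝ) + 1 := by positivity
  have hpos : (0 : ℝ) < 1 / ((n : ℝ) + 1) := by positivity
  let F : Nat.Primes → ℂ → ℕ → ℂ := fun p s j =>
    η (j + (n + 1)) * ((p : ℕ) : ℂ) ^ (-((j + (n + 1) : ℕ) : ℂ) * s)
  let c : ℝ → ℕ → ℝ := fun σ j => (A * ((j + (n + 1) : ℕ) : ℝ)) ^ B * ((2 : ℝ) ^ (-σ)) ^ j
  let d : ℝ → Nat.Primes → ℝ := fun σ p => ((p : ℕ) : ℝ) ^ (-(((n + 1 : ℕ) : ℝ) * σ))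
  have hc : ∀ σ : ℝ, 1 / ((n : ℝ) + 1) < σ → Summable (c σ) := fun σ hσ =>
    summable_mul_add_rpow_mul_geometric hA.le B n.succ_pos (by positivity)
      (Real.rpow_lt_one_of_one_lt_of_neg one_lt_two (neg_lt_zero.2 (hpos.trans hσ)))
  have hd : ∀ σ : ℝ, 1 / ((n : ℝ) + 1) < σ → Summable (d σ) := fun σ hσ => by
    refine Nat.Primes.summable_rpow.2 (neg_lt_neg ?_)
    rw [div_lt_iff₀' hn] at hσ
    exact_mod_cast hσ
  have hF : ∀ σ : ℝ, 1 / ((n : ℝ) + 1) < σ → ∀ (p : Nat.Primes) (s : ℂ), σ ≤ s.re →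
      ∀ j, ‖F p s j‖ ≤ c σ j * d σ p := fun σ hσ p s hs j => by
    rw [norm_mul, mul_assoc]
    have hσ0 : 0 ≤ σ := (hpos.trans hσ).le
    exact mul_le_mul (hη _ (Nat.le_add_left _ _))
      (norm_natCast_cpow_neg_add_mul_le p.2.two_le j (n + 1) hσ0 hs) (norm_nonneg _)
      (by positivity)
  have hsum : ∀ σ : ℝ, 1 / ((n : ℝ) + 1) < σ → ∀ (p : Nat.Primes) (s : ℂ), σ ≤ s.re →
      ‖∑' j, F p s j‖ ≤ (∑' j, c σ j) * d σ p := fun σ hσ p s hs =>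
    tsum_of_norm_bounded ((hc σ hσ).hasSum.mul_right _) (hF σ hσ p s hs)
  have hnorm : ∀ s : ℂ, 1 / ((n : ℝ) + 1) < s.re →
      Summable fun p : Nat.Primes => ‖∑' j, F p s j‖ := fun s hs =>
    ((hd _ hs).mul_left _).of_nonneg_of_le (fun _ => norm_nonneg _)
      (fun p => hsum _ hs p s le_rfl)
  refine ⟨fun s hs => ⟨fun p => ?_, hnorm s hs, multipliable_one_add_of_summable (hnorm s hs)⟩,
    fun s hs => ?_⟩
  · exact ((hc _ hs).mul_right _).of_nonneg_of_le (fun _ => norm_nonneg _) (hF _ hs p s le_rfl)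
  obtain ⟨σ, hσ, hσs⟩ := exists_between (Set.mem_ofPred.1 hs)
  have hU : IsOpen {z : ℂ | σ < z.re} := isOpen_lt continuous_const continuous_re
  have hdiff : ∀ p : Nat.Primes,
      DifferentiableOn ℂ (fun z => ∑' j, F p z j) {z : ℂ | σ < z.re} := fun p => by
    refine Complex.differentiableOn_tsum_of_summable_norm ((hc σ hσ).mul_right (d σ p))
      (fun j => ?_) hU (fun j z hz => hF σ hσ p z (le_of_lt hz) j)
    have hp : ((p : ℕ) : ℂ) ≠ 0 := Nat.cast_ne_zero.2 p.2.ne_zero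
    exact ((Differentiable.const_cpow (by fun_prop) (Or.inl hp)).const_mul _).differentiableOn
  have hprod : DifferentiableOn ℂ (fun z => ∏' p : Nat.Primes, (1 + ∑' j, F p z j))
      {z : ℂ | σ < z.re} :=
    (Summable.hasProdLocallyUniformlyOn_one_add hU ((hd σ hσ).mul_left (∑' j, c σ j))
      (.of_forall fun p z hz => hsum σ hσ p z (le_of_lt hz))
      (fun p => (hdiff p).continuousOn)).differentiableOn
      (.of_forall fun t => DifferentiableOn.fun_finsetProd fun p _ => (hdiff p).const_add 1) hU
  exact (hprod.differentiableAt (hU.mem_nhds hσs)).differentiableWithinAt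
end

section
/- Let f be a fake μ defined via the sequence (ε_j), and suppose there is an integer k ≥ 1 with ε_j = 0 for 1 ≤ j ≤ k−1 and ε_k = −1 (so f is of Möbius-type with initial index k). Then there exists a sequence of integers (η_j)_{j≥2k+1} with |η_j| ≤ (2j)^{2(k+1)} for all j ≥ 2k+1, such that for all s with Re s > 1: D_f(s) = ∏_p (1 + Σ_{j≥2k+1} η_j p^{−js}) · ∏_{j=k}^{2k} ζ(js)^{ε_j}. -/
open Complex

open PowerSeries in
/-- The geometric series `1 + X ^ j + X ^ (2 * j) + ⋯`, the inverse of `1 - X ^ j` for `j ≥ 1`. -/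
noncomputable def geomPowerSeries (j : ℕ) : ℤ⟦X⟧ := PowerSeries.mk fun n ↦ if j ∣ n then 1 else 0

open PowerSeries in
/-- The power series `(1 - X ^ j) ^ e` for `e ∈ {-1, 0, 1}`. -/
noncomputable def signPowOneSubXPow (e : ℤ) (j : ℕ) : ℤ⟦X⟧ :=
  if e = 1 then 1 - X ^ j else if e = -1 then geomPowerSeries j else 1

section Coefficients

open PowerSeries

lemma geomPowerSeries_mul_one_sub {j : ℕ} (hj : 1 ≤ j) :
    geomPowerSeries j * (1 - X ^ j) = 1 := by
  ext n
  rw [mul_sub, mul_one, map_sub, PowerSeries.coeff_mul_X_pow', coeff_one]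
  simp only [geomPowerSeries, coeff_mk]
  by_cases hn : j ≤ n
  · have h : j ∣ n - j ↔ j ∣ n := (Nat.dvd_sub_iff_left hn dvd_rfl)
    have hn0 : n ≠ 0 := by omega
    simp [hn, h, hn0]
  · have h : j ∣ n ↔ n = 0 :=
      ⟨fun h ↦ Nat.eq_zero_of_dvd_of_lt h (by omega), fun h ↦ h ▸ dvd_zero j⟩
    simp [hn, h]

lemma signPowOneSubXPow_neg_one (j : ℕ) : signPowOneSubXPow (-1) j = geomPowerSeries j := by
  simp [signPowOneSubXPow]

lemma abs_coeff_one_sub_X_pow_le {j : ℕ} (hj : 1 ≤ j) (n : ℕ) :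
    |coeff n (1 - X ^ j : ℤ⟦X⟧)| ≤ 1 := by
  rw [map_sub, coeff_one, coeff_X_pow]
  split_ifs <;> first | omega | simp

lemma abs_coeff_geomPowerSeries_le (j n : ℕ) : |coeff n (geomPowerSeries j)| ≤ 1 := by
  rw [geomPowerSeries, coeff_mk]
  split_ifs <;> simp

lemma abs_coeff_signPowOneSubXPow_le (e : ℤ) {j : ℕ} (hj : 1 ≤ j) (n : ℕ) :
    |coeff n (signPowOneSubXPow e j)| ≤ 1 := by
  unfold signPowOneSubXPow
  split_ifs
  · exact abs_coeff_one_sub_X_pow_le hj n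
  · exact abs_coeff_geomPowerSeries_le j n
  · rw [coeff_one]
    split_ifs <;> simp

lemma abs_coeff_mul_le {A B : ℤ⟦X⟧} {m : ℕ} (hA : ∀ n, |coeff n A| ≤ 1)
    (hB : ∀ n : ℕ, |coeff n B| ≤ ((n : ℤ) + 1) ^ m) (n : ℕ) :
    |coeff n (A * B)| ≤ ((n : ℤ) + 1) ^ (m + 1) := by
  rw [coeff_mul]
  calc |∑ q ∈ Finset.HasAntidiagonal.antidiagonal n, coeff q.1 A * coeff q.2 B|
      ≤ ∑ q ∈ Finset.HasAntidiagonal.antidiagonal n, |coeff q.1 A * coeff q.2 B| :=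
        Finset.abs_sum_le_sum_abs _ _
    _ ≤ ∑ q ∈ Finset.HasAntidiagonal.antidiagonal n, ((n : ℤ) + 1) ^ m := by
        refine Finset.sum_le_sum fun q hq ↦ ?_
        have hq2 : (q.2 : ℤ) ≤ n := by
          exact_mod_cast Finset.HasAntidiagonal.antidiagonal.snd_le hq
        rw [abs_mul]
        calc |coeff q.1 A| * |coeff q.2 B| ≤ 1 * ((q.2 : ℤ) + 1) ^ m :=
              mul_le_mul (hA _) (hB _) (abs_nonneg _) zero_le_one
          _ ≤ ((n : ℤ) + 1) ^ m := by rw [one_mul]; gcongr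
    _ = ((n : ℤ) + 1) ^ (m + 1) := by
        rw [Finset.sum_const, Finset.Nat.card_antidiagonal, nsmul_eq_mul, pow_succ']
        push_cast
        ring

lemma abs_coeff_mul_prod_le {ι : Type*} {F : ℤ⟦X⟧} {U : ι → ℤ⟦X⟧} (T : Finset ι)
    (hF : ∀ n, |coeff n F| ≤ 1) (hU : ∀ j ∈ T, ∀ n, |coeff n (U j)| ≤ 1) (n : ℕ) :
    |coeff n (F * ∏ j ∈ T, U j)| ≤ ((n : ℤ) + 1) ^ T.card := by
  classical
  induction T using Finset.induction_on generalizing n with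
  | empty => simpa using hF n
  | insert a T ha ih =>
    rw [Finset.prod_insert ha, Finset.card_insert_of_notMem ha, mul_left_comm]
    exact abs_coeff_mul_le (hU a (Finset.mem_insert_self a T))
      (ih fun j hj ↦ hU j (Finset.mem_insert_of_mem hj)) n

lemma X_pow_dvd_signPowOneSubXPow_sub {e : ℤ} {j N : ℕ} (he : e = -1 ∨ e = 0 ∨ e = 1)
    (hj : 1 ≤ j) (hN : N ≤ 2 * j) :
    (X : ℤ⟦X⟧) ^ N ∣ signPowOneSubXPow e j - (1 - C e * X ^ j) := by
  rcases he with rfl | rfl | rfl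
  · refine (pow_dvd_pow X hN).trans ⟨geomPowerSeries j, ?_⟩
    have h := geomPowerSeries_mul_one_sub hj
    simp only [signPowOneSubXPow_neg_one, map_neg, map_one]
    linear_combination (1 + X ^ j) * h
  · simp [signPowOneSubXPow]
  · simp [signPowOneSubXPow]

lemma X_pow_dvd_sum {N : ℕ} (ε : ℕ → ℤ) (T : Finset ℕ) (hT : ∀ j ∈ T, N ≤ j) :
    (X : ℤ⟦X⟧) ^ N ∣ ∑ j ∈ T, C (ε j) * X ^ j :=
  Finset.dvd_sum fun j hj ↦ (pow_dvd_pow X (hT j hj)).mul_left _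

lemma X_pow_dvd_prod_signPowOneSubXPow_sub {ε : ℕ → ℤ} {M : ℕ} (hM : 1 ≤ M) (T : Finset ℕ)
    (hε : ∀ j ∈ T, ε j = -1 ∨ ε j = 0 ∨ ε j = 1) (hT : ∀ j ∈ T, M ≤ j) :
    (X : ℤ⟦X⟧) ^ (2 * M) ∣
      ∏ j ∈ T, signPowOneSubXPow (ε j) j - (1 - ∑ j ∈ T, C (ε j) * X ^ j) := by
  induction T using Finset.induction_on with
  | empty => simp
  | insert a T ha ih =>
    rw [Finset.prod_insert ha, Finset.sum_insert ha]
    have hT' : ∀ j ∈ T, M ≤ j := fun j hj ↦ hT j (Finset.mem_insert_of_mem hj)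
    have haM := hT a (Finset.mem_insert_self a T)
    have h1 := ih (fun j hj ↦ hε j (Finset.mem_insert_of_mem hj)) hT'
    have h2 : (X : ℤ⟦X⟧) ^ (2 * M) ∣ _ := X_pow_dvd_signPowOneSubXPow_sub
      (hε a (Finset.mem_insert_self a T)) (hM.trans haM) (Nat.mul_le_mul_left 2 haM)
    have h3 : (X : ℤ⟦X⟧) ^ (2 * M) ∣ C (ε a) * X ^ a * ∑ j ∈ T, C (ε j) * X ^ j := by
      rw [two_mul, pow_add]
      exact mul_dvd_mul ((pow_dvd_pow X haM).mul_left _) (X_pow_dvd_sum ε T hT')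
    have h := ((h2.mul_right (∏ j ∈ T, signPowOneSubXPow (ε j) j)).add
      (h1.mul_left (1 - C (ε a) * X ^ a))).add h3
    convert h using 1
    ring

lemma X_pow_dvd_mul_prod_signPowOneSubXPow_sub_one {ε : ℕ → ℤ} {k : ℕ} (hk : 1 ≤ k)
    (hε : ∀ j : ℕ, 1 ≤ j → ε j = -1 ∨ ε j = 0 ∨ ε j = 1)
    (hzero : ∀ j : ℕ, 1 ≤ j → j ≤ k - 1 → ε j = 0) (hεk : ε k = -1)
    {F : ℤ⟦X⟧} (hF0 : coeff 0 F = 1) (hF : ∀ j : ℕ, 1 ≤ j → coeff j F = ε j) :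
    (X : ℤ⟦X⟧) ^ (2 * k + 1) ∣
      F * ∏ j ∈ Finset.Icc k (2 * k), signPowOneSubXPow (ε j) j - 1 := by
  set S : ℤ⟦X⟧ := ∑ j ∈ Finset.Ioc k (2 * k), C (ε j) * X ^ j with hS
  have hSdvd : (X : ℤ⟦X⟧) ^ (k + 1) ∣ S :=
    X_pow_dvd_sum ε _ fun j hj ↦ (Finset.mem_Ioc.1 hj).1
  have hFdvd : (X : ℤ⟦X⟧) ^ (2 * k + 1) ∣ F - (1 - X ^ k + S) := by
    rw [PowerSeries.X_pow_dvd_iff]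
    intro m hm
    have hSm : coeff m S = if k < m then ε m else 0 := by
      rw [hS, map_sum]
      simp only [coeff_C_mul, coeff_X_pow, mul_ite, mul_one, mul_zero]
      rw [Finset.sum_ite_eq]
      have : m ∈ Finset.Ioc k (2 * k) ↔ k < m := by rw [Finset.mem_Ioc]; omega
      simp [this]
    rw [map_sub, map_add, map_sub, coeff_one, coeff_X_pow, hSm]
    rcases Nat.eq_zero_or_pos m with rfl | hm0
    · have : (0 : ℕ) ≠ k := by omega
      simp [hF0, this]
    · rw [hF m hm0, if_neg hm0.ne']
      rcases lt_trichotomy m k with h | rfl | h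
      · rw [hzero m hm0 (by omega), if_neg h.ne, if_neg h.not_gt]
        simp
      · simp [hεk]
      · rw [if_neg h.ne', if_pos h]
        simp
  have hP : (X : ℤ⟦X⟧) ^ (2 * k + 1) ∣
      ∏ j ∈ Finset.Ioc k (2 * k), signPowOneSubXPow (ε j) j - (1 - S) :=
    (pow_dvd_pow X (by omega)).trans <| X_pow_dvd_prod_signPowOneSubXPow_sub (M := k + 1)
      (by omega) _ (fun j hj ↦ hε j (by have := Finset.mem_Ioc.1 hj; omega))
      fun j hj ↦ (Finset.mem_Ioc.1 hj).1
  have hcross : (X : ℤ⟦X⟧) ^ (2 * k + 1) ∣ (X ^ k - S) * S := by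
    rw [show 2 * k + 1 = k + (k + 1) by ring, pow_add]
    exact mul_dvd_mul (dvd_sub dvd_rfl ((pow_dvd_pow X (by omega)).trans hSdvd)) hSdvd
  rw [← Finset.mul_prod_Ioc_eq_prod_Icc (by omega : k ≤ 2 * k), hεk,
    signPowOneSubXPow_neg_one]
  have hG := geomPowerSeries_mul_one_sub hk
  have h := (((hFdvd.mul_right (∏ j ∈ Finset.Ioc k (2 * k), signPowOneSubXPow (ε j) j)).add
    (hP.mul_left (1 - X ^ k + S))).add hcross).mul_left (geomPowerSeries k)
  convert h using 1
  linear_combination hG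

end Coefficients

section Evaluation

open PowerSeries

/-- The series obtained by substituting `x` in the power series `A` converges absolutely to `v`. -/
noncomputable def HasAbsEval (A : PowerSeries ℤ) (x v : ℂ) : Prop :=
  Summable (fun n ↦ ‖((coeff n A : ℤ) : ℂ) * x ^ n‖) ∧ HasSum (fun n ↦ ((coeff n A : ℤ) : ℂ) * x ^ n) v

namespace HasAbsEval

lemma mul {A B : ℤ⟦X⟧} {x v w : ℂ} (hA : HasAbsEval A x v) (hB : HasAbsEval B x w) :
    HasAbsEval (A * B) x (v * w) := by
  have key (n : ℕ) : ((coeff n (A * B) : ℤ) : ℂ) * x ^ n = ∑ q ∈ Finset.HasAntidiagonal.antidiagonal n,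
      (((coeff q.1 A : ℤ) : ℂ) * x ^ q.1) * (((coeff q.2 B : ℤ) : ℂ) * x ^ q.2) := by
    rw [coeff_mul, Int.cast_sum, Finset.sum_mul]
    refine Finset.sum_congr rfl fun q hq ↦ ?_
    rw [← Finset.HasAntidiagonal.mem_antidiagonal.1 hq, pow_add]
    push_cast
    ring
  let a : ℕ → ℂ := fun n ↦ ((coeff n A : ℤ) : ℂ) * x ^ n
  let b : ℕ → ℂ := fun n ↦ ((coeff n B : ℤ) : ℂ) * x ^ n
  have hab : (fun n ↦ ((coeff n (A * B) : ℤ) : ℂ) * x ^ n) =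
      fun n ↦ ∑ q ∈ Finset.HasAntidiagonal.antidiagonal n, a q.1 * b q.2 := funext key
  have ha : Summable fun n ↦ ‖a n‖ := hA.1
  have hb : Summable fun n ↦ ‖b n‖ := hB.1
  have hs := summable_norm_sum_mul_antidiagonal_of_summable_norm ha hb
  have hsum : HasSum (fun n ↦ ∑ q ∈ Finset.HasAntidiagonal.antidiagonal n, a q.1 * b q.2)
      (v * w) := by
    rw [← hA.2.tsum_eq, ← hB.2.tsum_eq,
      tsum_mul_tsum_eq_tsum_sum_antidiagonal_of_summable_norm ha hb]
    exact hs.of_norm.hasSum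
  rw [← hab] at hsum
  exact ⟨hs.congr fun n ↦ congrArg norm (key n).symm, hsum⟩

lemma unique {A : ℤ⟦X⟧} {x v w : ℂ} (h : HasAbsEval A x v) (h' : HasAbsEval A x w) : v = w :=
  h.2.unique h'.2

lemma X_pow (j : ℕ) (x : ℂ) : HasAbsEval (X ^ j) x (x ^ j) := by
  have h0 (n : ℕ) (hn : n ≠ j) : ((coeff n (X ^ j : ℤ⟦X⟧) : ℤ) : ℂ) * x ^ n = 0 := by
    simp [coeff_X_pow, hn]
  constructor
  · exact summable_of_ne_finset_zero (s := {j}) fun n hn ↦ by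
      rw [h0 n (by simpa using hn), norm_zero]
  · simpa [coeff_X_pow] using hasSum_single j h0

lemma one (x : ℂ) : HasAbsEval 1 x 1 := by
  simpa using X_pow 0 x

lemma sub {A B : ℤ⟦X⟧} {x v w : ℂ} (hA : HasAbsEval A x v) (hB : HasAbsEval B x w) :
    HasAbsEval (A - B) x (v - w) := by
  have key (n : ℕ) : ((coeff n (A - B) : ℤ) : ℂ) * x ^ n =
      ((coeff n A : ℤ) : ℂ) * x ^ n - ((coeff n B : ℤ) : ℂ) * x ^ n := by
    rw [map_sub]
    push_cast
    ring
  constructor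
  · simp only [key]
    exact (hA.1.add hB.1).of_nonneg_of_le (fun _ ↦ norm_nonneg _) fun _ ↦ norm_sub_le _ _
  · simp only [key]
    exact hA.2.sub hB.2

lemma prod {ι : Type*} (T : Finset ι) {U : ι → ℤ⟦X⟧} {x : ℂ} {v : ι → ℂ}
    (h : ∀ j ∈ T, HasAbsEval (U j) x (v j)) :
    HasAbsEval (∏ j ∈ T, U j) x (∏ j ∈ T, v j) := by
  classical
  induction T using Finset.induction_on with
  | empty => simpa using one x
  | insert a T ha ih =>
    rw [Finset.prod_insert ha, Finset.prod_insert ha]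
    exact (h a (Finset.mem_insert_self a T)).mul
      (ih fun j hj ↦ h j (Finset.mem_insert_of_mem hj))

lemma of_abs_coeff_le_one {A : ℤ⟦X⟧} (hA : ∀ n, |coeff n A| ≤ 1) {x : ℂ} (hx : ‖x‖ < 1) :
    HasAbsEval A x (∑' n, ((coeff n A : ℤ) : ℂ) * x ^ n) := by
  have hs : Summable (fun n ↦ ‖((coeff n A : ℤ) : ℂ) * x ^ n‖) := by
    refine (summable_geometric_of_lt_one (norm_nonneg x) hx).of_nonneg_of_le
      (fun _ ↦ norm_nonneg _) fun n ↦ ?_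
    rw [norm_mul, norm_pow, Complex.norm_intCast]
    have : |((coeff n A : ℤ) : ℝ)| ≤ 1 := by exact_mod_cast hA n
    exact mul_le_of_le_one_left (by positivity) this
  exact ⟨hs, hs.of_norm.hasSum⟩

lemma signPowOneSubXPow {e : ℤ} (he : e = -1 ∨ e = 0 ∨ e = 1) {j : ℕ} (hj : 1 ≤ j) {x : ℂ}
    (hx : ‖x‖ < 1) : HasAbsEval (signPowOneSubXPow e j) x ((1 - x ^ j) ^ e) := by
  have h1 : HasAbsEval (1 - X ^ j) x (1 - x ^ j) := (one x).sub (X_pow j x)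
  rcases he with rfl | rfl | rfl
  · rw [signPowOneSubXPow_neg_one, zpow_neg_one]
    have h := of_abs_coeff_le_one (abs_coeff_geomPowerSeries_le j) hx
    have hmul := h.mul h1
    rw [geomPowerSeries_mul_one_sub hj] at hmul
    rwa [eq_inv_of_mul_eq_one_left (hmul.unique (one x))] at h
  · simpa [_root_.signPowOneSubXPow] using one x
  · simpa [_root_.signPowOneSubXPow] using h1

lemma one_add_tsum_eq {A : ℤ⟦X⟧} {x v : ℂ} (h : HasAbsEval A x v) {N : ℕ} (hN : 1 ≤ N)
    (hA : (X : ℤ⟦X⟧) ^ N ∣ A - 1) :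
    1 + ∑' j : ℕ, ((coeff (j + N) A : ℤ) : ℂ) * x ^ (j + N) = v := by
  rw [← h.2.tsum_eq, ← h.1.of_norm.sum_add_tsum_nat_add N]
  congr 1
  rw [PowerSeries.X_pow_dvd_iff] at hA
  rw [Finset.sum_eq_single_of_mem 0 (Finset.mem_range.2 hN)]
  · have := hA 0 hN
    rw [map_sub, coeff_zero_one, sub_eq_zero] at this
    simp [this]
  · intro m hm hm0
    have := hA m (Finset.mem_range.1 hm)
    rw [map_sub, coeff_one, if_neg hm0, sub_zero] at this
    simp [this]

end HasAbsEval

end Evaluation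

section EulerProduct

lemma abs_le_one_of_multiplicative {f : ℕ → ℤ} (hf1 : f 1 = 1)
    (hmul : ∀ m n : ℕ, Nat.Coprime m n → f (m * n) = f m * f n)
    (hpow : ∀ p : ℕ, p.Prime → ∀ j : ℕ, 1 ≤ j → |f (p ^ j)| ≤ 1) {n : ℕ} (hn : n ≠ 0) :
    |f n| ≤ 1 := by
  induction n using Nat.recOnPosPrimePosCoprime with
  | prime_pow p j hp hj => exact hpow p hp j hj
  | zero => exact absurd rfl hn
  | one => simp [hf1]
  | coprime a b ha hb hab iha ihb =>
    rw [hmul a b hab, abs_mul]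
    exact mul_le_one₀ (iha (by omega)) (abs_nonneg _) (ihb (by omega))

lemma prime_norm_cpow_neg_lt_one {p : ℕ} (hp : p.Prime) {s : ℂ} (hs : 1 < s.re) :
    ‖(p : ℂ) ^ (-s)‖ < 1 := by
  rw [Complex.norm_natCast_cpow_of_pos hp.pos]
  exact Real.rpow_lt_one_of_one_lt_of_neg (by exact_mod_cast hp.one_lt)
    (by rw [Complex.neg_re]; linarith)

lemma hasProd_riemannZeta_zpow_neg {e : ℤ} (he : e = -1 ∨ e = 0 ∨ e = 1) {s : ℂ}
    (hs : 1 < s.re) :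
    HasProd (fun p : Nat.Primes ↦ (1 - ((p : ℕ) : ℂ) ^ (-s)) ^ e) (riemannZeta s ^ (-e)) := by
  have h := riemannZeta_eulerProduct_hasProd hs
  rcases he with rfl | rfl | rfl
  · simpa using h
  · simp
  · simpa using h.inv₀ (riemannZeta_ne_zero_of_one_lt_re hs)

lemma hasProd_tsum_primePow_of_multiplicative {f : ℕ → ℤ} (hf1 : f 1 = 1)
    (hmul : ∀ m n : ℕ, Nat.Coprime m n → f (m * n) = f m * f n)
    (hf : ∀ n : ℕ, n ≠ 0 → |f n| ≤ 1) {s : ℂ} (hs : 1 < s.re) :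
    HasProd (fun p : Nat.Primes ↦ ∑' j : ℕ, (f ((p : ℕ) ^ j) : ℂ) * (((p : ℕ) : ℂ) ^ (-s)) ^ j)
      (∑' m : ℕ, (f m : ℂ) / (m : ℂ) ^ s) := by
  have hs0 : s ≠ 0 := by
    rintro rfl
    norm_num at hs
  have hsum : Summable fun n : ℕ ↦ ‖(f n : ℂ) / (n : ℂ) ^ s‖ := by
    refine (Complex.summable_one_div_nat_cpow.2 hs).norm.of_nonneg_of_le
      (fun _ ↦ norm_nonneg _) fun n ↦ ?_
    rcases eq_or_ne n 0 with rfl | hn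
    · simp [hs0]
    · rw [norm_div, norm_div, Complex.norm_intCast, norm_one]
      have : |(f n : ℝ)| ≤ 1 := by exact_mod_cast hf n hn
      gcongr
  have h := EulerProduct.eulerProduct_hasProd (f := fun n : ℕ ↦ (f n : ℂ) / (n : ℂ) ^ s)
    (by simp [hf1])
    (fun {m n} hmn ↦ by
      simp only [hmul m n hmn, Nat.cast_mul, Complex.natCast_mul_natCast_cpow, Int.cast_mul]
      exact mul_div_mul_comm _ _ _ _) hsum (by simp [hs0])
  refine h.congr_fun ?_
  intro p
  refine tsum_congr fun j ↦ ?_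
  rw [Nat.cast_pow, Complex.cpow_neg, inv_pow, div_eq_mul_inv, ← Complex.natCast_cpow_natCast_mul, Complex.cpow_nat_mul]

end EulerProduct

/-- zeta-factorization for Möbius-type fake μ's.
If `f` is a fake μ defined via `(ε_j)` with `ε_j = 0` for `1 ≤ j ≤ k-1` and
`ε_k = -1`, then there are integers `η_j` (for `j ≥ 2k+1`) with
`|η_j| ≤ (2j)^{2(k+1)}` such that for `Re s > 1`,
`D_f(s) = ∏_p (1 + Σ_{j ≥ 2k+1} η_j p^{-js}) · ∏_{j=k}^{2k} ζ(js)^{ε_j}`. -/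
theorem stmt_2 (f : ℕ → ℤ) (ε : ℕ → ℤ)
    (hf1 : f 1 = 1)
    (hmul : ∀ m n : ℕ, Nat.Coprime m n → f (m * n) = f m * f n)
    (hεval : ∀ j : ℕ, 1 ≤ j → ε j = -1 ∨ ε j = 0 ∨ ε j = 1)
    (hfp : ∀ p : ℕ, Nat.Prime p → ∀ j : ℕ, 1 ≤ j → f (p ^ j) = ε j)
    (k : ℕ) (hk : 1 ≤ k)
    (hzero : ∀ j : ℕ, 1 ≤ j → j ≤ k - 1 → ε j = 0)
    (hεk : ε k = -1) :
    ∃ η : ℕ → ℤ,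
      (∀ j : ℕ, 2 * k + 1 ≤ j → (η j).natAbs ≤ (2 * j) ^ (2 * (k + 1))) ∧
      ∀ s : ℂ, 1 < s.re →
        ∑' m : ℕ, (f m : ℂ) / (m : ℂ) ^ s =
          (∏' p : Nat.Primes,
            (1 + ∑' j : ℕ, (η (j + (2 * k + 1)) : ℂ) *
              ((p : ℕ) : ℂ) ^ (-(((j + (2 * k + 1) : ℕ) : ℂ)) * s))) *
          ∏ j ∈ Finset.Icc k (2 * k), riemannZeta ((j : ℂ) * s) ^ (ε j) := by
  let F : PowerSeries ℤ := PowerSeries.mk fun n ↦ if n = 0 then 1 else ε n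
  let H : PowerSeries ℤ := F * ∏ j ∈ Finset.Icc k (2 * k), signPowOneSubXPow (ε j) j
  have hε_abs (j : ℕ) (hj : 1 ≤ j) : |ε j| ≤ 1 := by
    rcases hεval j hj with h | h | h <;> simp [h]
  have hF_abs (n : ℕ) : |PowerSeries.coeff n F| ≤ 1 := by
    rw [PowerSeries.coeff_mk]
    split_ifs with h
    · simp
    · exact hε_abs n (by omega)
  have hIcc (j : ℕ) (hj : j ∈ Finset.Icc k (2 * k)) : 1 ≤ j := hk.trans (Finset.mem_Icc.1 hj).1
  have hH : (PowerSeries.X : PowerSeries ℤ) ^ (2 * k + 1) ∣ H - 1 :=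
    X_pow_dvd_mul_prod_signPowOneSubXPow_sub_one hk hεval hzero hεk (by simp [F])
      fun j hj ↦ by
        have : j ≠ 0 := by omega
        simp [F, this]
  refine ⟨fun j ↦ PowerSeries.coeff j H, fun j hj ↦ ?_, fun s hs ↦ ?_⟩
  · have h := abs_coeff_mul_prod_le (Finset.Icc k (2 * k)) hF_abs
      (fun i hi ↦ abs_coeff_signPowOneSubXPow_le (ε i) (hIcc i hi)) j
    rw [Nat.card_Icc, show 2 * k + 1 - k = k + 1 by omega] at h
    have h' : (PowerSeries.coeff j H).natAbs ≤ (j + 1) ^ (k + 1) := by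
      zify
      exact h
    calc (PowerSeries.coeff j H).natAbs ≤ (j + 1) ^ (k + 1) := h'
      _ ≤ (2 * j) ^ (k + 1) := Nat.pow_le_pow_left (by omega) _
      _ ≤ (2 * j) ^ (2 * (k + 1)) := Nat.pow_le_pow_right (by omega) (by omega)
  · have hjs (j : ℕ) (hj : j ∈ Finset.Icc k (2 * k)) : 1 < ((j : ℂ) * s).re := by
      have hj1 : (1 : ℝ) ≤ j := by exact_mod_cast hIcc j hj
      rw [← Complex.ofReal_natCast, Complex.re_ofReal_mul]
      nlinarith
    have hlocal (p : Nat.Primes) :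
        1 + ∑' j : ℕ, ((PowerSeries.coeff (j + (2 * k + 1)) H : ℤ) : ℂ) *
            ((p : ℕ) : ℂ) ^ (-(((j + (2 * k + 1) : ℕ) : ℂ)) * s) =
          (∑' j : ℕ, (f ((p : ℕ) ^ j) : ℂ) * (((p : ℕ) : ℂ) ^ (-s)) ^ j) *
            ∏ j ∈ Finset.Icc k (2 * k), (1 - ((p : ℕ) : ℂ) ^ (-((j : ℂ) * s))) ^ ε j := by
      have hx := prime_norm_cpow_neg_lt_one p.2 hs
      have hpow (n : ℕ) : ((p : ℕ) : ℂ) ^ (-((n : ℂ) * s)) = (((p : ℕ) : ℂ) ^ (-s)) ^ n := by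
        rw [← Complex.cpow_nat_mul, mul_neg]
      have hcoeff (j : ℕ) : f ((p : ℕ) ^ j) = PowerSeries.coeff j F := by
        rw [PowerSeries.coeff_mk]
        split_ifs with h
        · simp [h, hf1]
        · exact hfp p p.2 j (by omega)
      simp only [neg_mul, hpow, hcoeff]
      exact ((HasAbsEval.of_abs_coeff_le_one hF_abs hx).mul
        (HasAbsEval.prod _ fun j hj ↦ HasAbsEval.signPowOneSubXPow
          (hεval j (hIcc j hj)) (hIcc j hj) hx)).one_add_tsum_eq (by omega) hH
    have hD := hasProd_tsum_primePow_of_multiplicative hf1 hmul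
      (fun n hn ↦ abs_le_one_of_multiplicative hf1 hmul
        (fun p hp j hj ↦ by rw [hfp p hp j hj]; exact hε_abs j hj) hn) hs
    have hZ := hasProd_prod fun j hj ↦
      hasProd_riemannZeta_zpow_neg (hεval j (hIcc j hj)) (hjs j hj)
    rw [tprod_congr hlocal, (hD.mul hZ).tprod_eq, mul_assoc, ← Finset.prod_mul_distrib,
      Finset.prod_eq_one, mul_one]
    intro j hj
    rw [zpow_neg, inv_mul_cancel₀ (zpow_ne_zero _ (riemannZeta_ne_zero_of_one_lt_re (hjs j hj)))]
end

section
/- Let y, z : ℕ → ℝ be sequences such that Σ_{n≥1} |y_n| n^{−σ} < ∞ for every σ > 1, and let k ≥ 1 be an integer such that Σ_{n≥1} |z_n| n^{−σ} < ∞ for every σ > 1/(k+1). Suppose there are real numbers r_1,…,r_k and a function R : [1,∞) → ℝ with Σ_{n≤x} y_n = Σ_{j=1}^k r_j x^{1/j} + R(x) for all x ≥ 1. Let f = y ∗ z be the Dirichlet convolution (f(n) = Σ_{d|n} y_d z_{n/d}) and set G(x) = Σ_{j=1}^k (Σ_{n≥1} z_n n^{−1/j}) r_j x^{1/j}. Then: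 (a) if R(x) ≪ 1, then for every ε > 0 one has Σ_{n≤x} f(n) − G(x) ≪_ε x^{1/(k+1)+ε}; (b) if θ > 1/(k+1) is real and R̃ : [1,∞) → (0,∞) is eventually increasing with R(x) ≪ x^θ R̃(x), then Σ_{n≤x} f(n) − G(x) ≪ x^θ R̃(x). -/
open Filter

/-- The summatory function of a Dirichlet convolution, summed over the second factor. -/
theorem sum_Icc_sum_divisors_mul {A : Type*} [CommSemiring A] (y z : ℕ → A) (N : ℕ) :
    ∑ n ∈ Finset.Icc 1 N, ∑ d ∈ n.divisors, y d * z (n / d) =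
      ∑ m ∈ Finset.Icc 1 N, z m * ∑ d ∈ Finset.Icc 1 (N / m), y d := by
  let a : ArithmeticFunction A := ⟨fun n => if n = 0 then 0 else y n, by simp⟩
  let b : ArithmeticFunction A := ⟨fun n => if n = 0 then 0 else z n, by simp⟩
  have ha : ∀ n, n ≠ 0 → a n = y n := fun n hn => if_neg hn
  have hb : ∀ n, n ≠ 0 → b n = z n := fun n hn => if_neg hn
  have h := ArithmeticFunction.sum_Ioc_mul_eq_sum_sum b a N
  have hIoc : ∀ M : ℕ, Finset.Ioc 0 M = Finset.Icc 1 M := fun M => by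
    ext
    simp [Nat.lt_iff_add_one_le]
  simp only [hIoc] at h
  have hl : ∑ n ∈ Finset.Icc 1 N, ∑ d ∈ n.divisors, y d * z (n / d) =
      ∑ n ∈ Finset.Icc 1 N, (b * a) n := by
    refine Finset.sum_congr rfl fun n _ => ?_
    rw [mul_comm b a, ArithmeticFunction.mul_apply,
      Nat.sum_divisorsAntidiagonal (fun i j => a i * b j)]
    refine Finset.sum_congr rfl fun d hd => ?_
    obtain ⟨hdn, hn⟩ := Nat.mem_divisors.1 hd
    rw [ha d (ne_zero_of_dvd_ne_zero hn hdn),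
      hb _ (Nat.div_ne_zero_iff_of_dvd hdn |>.2 ⟨hn, ne_zero_of_dvd_ne_zero hn hdn⟩)]
  rw [hl, h]
  refine Finset.sum_congr rfl fun m hm => ?_
  rw [hb m (by have := (Finset.mem_Icc.1 hm).1; omega)]
  congr 1
  refine Finset.sum_congr rfl fun d hd => ?_
  rw [ha d (by have := (Finset.mem_Icc.1 hd).1; omega)]

/-- The tail of a convergent Dirichlet series, compared with a convergence exponent further left. -/
theorem abs_tsum_sub_sum_Icc_le {z : ℕ → ℝ} {σ s : ℝ} (hσs : σ ≤ s) (hs : 0 < s)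
    (hz : Summable fun n : ℕ => |z n| * (n : ℝ) ^ (-σ)) {x : ℝ} (hx : 0 < x) :
    |∑' m : ℕ, z m * (m : ℝ) ^ (-s) - ∑ m ∈ Finset.Icc 1 ⌊x⌋₊, z m * (m : ℝ) ^ (-s)| ≤
      x ^ (σ - s) * ∑' n : ℕ, |z n| * (n : ℝ) ^ (-σ) := by
  have hsum : Summable fun m : ℕ => z m * (m : ℝ) ^ (-s) := by
    refine Summable.of_norm_bounded hz fun m => ?_
    rw [Real.norm_eq_abs, abs_mul, abs_of_nonneg (Real.rpow_nonneg m.cast_nonneg (-s))]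
    rcases Nat.eq_zero_or_pos m with rfl | hm
    · rw [Nat.cast_zero, Real.zero_rpow (neg_ne_zero.2 hs.ne'), mul_zero]
      exact mul_nonneg (abs_nonneg _) (Real.rpow_nonneg le_rfl _)
    · gcongr
      exact_mod_cast hm
  have hfin : HasSum (fun m : ℕ => if m ∈ Finset.Icc 1 ⌊x⌋₊ then z m * (m : ℝ) ^ (-s) else 0)
      (∑ m ∈ Finset.Icc 1 ⌊x⌋₊, z m * (m : ℝ) ^ (-s)) := by
    have h := hasSum_sum_of_ne_finset_zero (L := .unconditional ℕ) (s := Finset.Icc 1 ⌊x⌋₊)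
      (f := fun m : ℕ => if m ∈ Finset.Icc 1 ⌊x⌋₊ then z m * (m : ℝ) ^ (-s) else 0)
      fun b hb => if_neg hb
    rwa [Finset.sum_congr rfl fun m hm => if_pos hm] at h
  have hdiff := hsum.hasSum.sub hfin
  rw [← hdiff.tsum_eq, ← Real.norm_eq_abs]
  refine tsum_of_norm_bounded (hz.hasSum.mul_left _) fun m => ?_
  have hrhs : 0 ≤ x ^ (σ - s) * (|z m| * (m : ℝ) ^ (-σ)) := by positivity
  split_ifs with hm
  · simpa using hrhs
  rcases Nat.eq_zero_or_pos m with rfl | hm0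
  · rw [Nat.cast_zero, Real.zero_rpow (neg_ne_zero.2 hs.ne'), mul_zero, sub_zero, norm_zero]
    simpa using hrhs
  have hxm : x ≤ m := by
    by_contra! h
    exact hm (Finset.mem_Icc.2 ⟨hm0, Nat.le_floor h.le⟩)
  have hm0' : (0 : ℝ) < m := by exact_mod_cast hm0
  rw [sub_zero, Real.norm_eq_abs, abs_mul, abs_of_nonneg (Real.rpow_nonneg hm0'.le _)]
  calc |z m| * (m : ℝ) ^ (-s) = (m : ℝ) ^ (σ - s) * (|z m| * (m : ℝ) ^ (-σ)) := by
        rw [mul_left_comm, ← Real.rpow_add hm0']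
        congr 2
        ring
    _ ≤ x ^ (σ - s) * (|z m| * (m : ℝ) ^ (-σ)) := by
        gcongr ?_ * _
        exact Real.rpow_le_rpow_of_nonpos hx hxm (by linarith)

/-- The remainder in a summatory function is bounded on bounded intervals. -/
theorem exists_abs_remainder_le {k : ℕ} {y r : ℕ → ℝ} {R : ℝ → ℝ}
    (hT : ∀ x : ℝ, 1 ≤ x →
      ∑ n ∈ Finset.Icc 1 ⌊x⌋₊, y n = ∑ j ∈ Finset.Icc 1 k, r j * x ^ (1 / (j : ℝ)) + R x)
    (X : ℝ) : ∃ B : ℝ, 0 ≤ B ∧ ∀ t : ℝ, 1 ≤ t → t ≤ X → |R t| ≤ B := by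
  refine ⟨∑ n ∈ Finset.Icc 1 ⌊X⌋₊, |y n| + ∑ j ∈ Finset.Icc 1 k, |r j| * |X| ^ (1 / (j : ℝ)),
    by positivity, fun t ht htX => ?_⟩
  have hR : R t = ∑ n ∈ Finset.Icc 1 ⌊t⌋₊, y n - ∑ j ∈ Finset.Icc 1 k, r j * t ^ (1 / (j : ℝ)) := by
    rw [hT t ht]; ring
  rw [hR]
  refine (abs_sub _ _).trans (add_le_add ?_ ?_)
  · refine (Finset.abs_sum_le_sum_abs _ _).trans
      (Finset.sum_le_sum_of_subset_of_nonneg ?_ fun _ _ _ => abs_nonneg _)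
    exact Finset.Icc_subset_Icc_right (Nat.floor_mono htX)
  · refine (Finset.abs_sum_le_sum_abs _ _).trans (Finset.sum_le_sum fun j _ => ?_)
    rw [abs_mul, abs_of_nonneg (Real.rpow_nonneg (by linarith : (0 : ℝ) ≤ t) _)]
    gcongr
    exact htX.trans (le_abs_self X)

/-- The error in the convolution method, split into the contribution of the remainder and
the tails of the Dirichlet series. -/
theorem sum_convolution_sub_eq {k : ℕ} {y z r : ℕ → ℝ} {R : ℝ → ℝ}
    (hT : ∀ x : ℝ, 1 ≤ x →
      ∑ n ∈ Finset.Icc 1 ⌊x⌋₊, y n = ∑ j ∈ Finset.Icc 1 k, r j * x ^ (1 / (j : ℝ)) + R x)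
    (S : ℕ → ℝ) {x : ℝ} (hx : 1 ≤ x) :
    ∑ n ∈ Finset.Icc 1 ⌊x⌋₊, ∑ d ∈ n.divisors, y d * z (n / d) -
        ∑ j ∈ Finset.Icc 1 k, S j * (r j * x ^ (1 / (j : ℝ))) =
      ∑ m ∈ Finset.Icc 1 ⌊x⌋₊, z m * R (x / m) -
        ∑ j ∈ Finset.Icc 1 k, (S j - ∑ m ∈ Finset.Icc 1 ⌊x⌋₊, z m * (m : ℝ) ^ (-(1 / (j : ℝ)))) *
          (r j * x ^ (1 / (j : ℝ))) := by
  have hm : ∀ m ∈ Finset.Icc 1 ⌊x⌋₊, z m * ∑ d ∈ Finset.Icc 1 (⌊x⌋₊ / m), y d =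
      ∑ j ∈ Finset.Icc 1 k, z m * (m : ℝ) ^ (-(1 / (j : ℝ))) * (r j * x ^ (1 / (j : ℝ))) +
        z m * R (x / m) := by
    intro m hm
    obtain ⟨hm1, hmx⟩ := Finset.mem_Icc.1 hm
    have hm0 : (0 : ℝ) < m := by exact_mod_cast hm1
    have hmx' : (m : ℝ) ≤ x := (Nat.le_floor_iff (by linarith)).1 hmx
    rw [← Nat.floor_div_natCast, hT _ ((one_le_div hm0).2 hmx'), mul_add, Finset.mul_sum]
    congr 1
    refine Finset.sum_congr rfl fun j _ => ?_
    rw [Real.div_rpow (by linarith) hm0.le, Real.rpow_neg hm0.le]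
    ring
  rw [sum_Icc_sum_divisors_mul, Finset.sum_congr rfl hm, Finset.sum_add_distrib, Finset.sum_comm]
  simp only [sub_mul, Finset.sum_sub_distrib, Finset.sum_mul]
  ring

/-- The convolution method with a remainder bounded by `x ^ θ` times an eventually monotone
function. -/
theorem exists_abs_sum_convolution_sub_le {k : ℕ} {y z r : ℕ → ℝ} {R : ℝ → ℝ}
    (hz : ∀ σ : ℝ, 1 / ((k : ℝ) + 1) < σ → Summable (fun n : ℕ => |z n| * (n : ℝ) ^ (-σ)))
    (hT : ∀ x : ℝ, 1 ≤ x →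
      ∑ n ∈ Finset.Icc 1 ⌊x⌋₊, y n = ∑ j ∈ Finset.Icc 1 k, r j * x ^ (1 / (j : ℝ)) + R x)
    {θ : ℝ} (hθ : 1 / ((k : ℝ) + 1) < θ) {Rt : ℝ → ℝ} (hpos : ∀ x : ℝ, 1 ≤ x → 0 < Rt x)
    (hmono : ∃ x₀ : ℝ, ∀ x₁ x₂ : ℝ, x₀ ≤ x₁ → x₁ ≤ x₂ → Rt x₁ ≤ Rt x₂)
    (hR : ∃ C : ℝ, ∀ᶠ x : ℝ in atTop, |R x| ≤ C * x ^ θ * Rt x) :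
    ∃ C : ℝ, ∀ᶠ x : ℝ in atTop,
      |∑ n ∈ Finset.Icc 1 ⌊x⌋₊, ∑ d ∈ n.divisors, y d * z (n / d) -
        ∑ j ∈ Finset.Icc 1 k, (∑' m : ℕ, z m * (m : ℝ) ^ (-(1 / (j : ℝ)))) *
          (r j * x ^ (1 / (j : ℝ)))| ≤ C * x ^ θ * Rt x := by
  obtain ⟨x₀, hmono⟩ := hmono
  obtain ⟨C, hC⟩ := hR
  obtain ⟨x₁, hC⟩ := eventually_atTop.1 hC
  set X : ℝ := max 1 (max x₀ x₁)
  have hX1 : 1 ≤ X := le_max_left _ _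
  have hX0 : x₀ ≤ X := (le_max_left _ _).trans (le_max_right _ _)
  have hXC : x₁ ≤ X := (le_max_right _ _).trans (le_max_right _ _)
  obtain ⟨B, hB0, hB⟩ := exists_abs_remainder_le hT X
  have hc : 0 < Rt X := hpos X hX1
  have hθ0 : 0 < θ := lt_trans (by positivity) hθ
  set K : ℝ := max C (B / Rt X)
  have hK0 : 0 ≤ K := le_max_of_le_right (by positivity)
  have hRK : ∀ x t : ℝ, X ≤ x → 1 ≤ t → t ≤ x → |R t| ≤ K * t ^ θ * Rt x := by
    intro x t hXx ht htx
    have ht0 : 0 ≤ t := by linarith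
    rcases le_total X t with h | h
    · have hRt : 0 < Rt t := hpos t ht
      calc |R t| ≤ C * t ^ θ * Rt t := hC t (hXC.trans h)
        _ ≤ K * t ^ θ * Rt x := by
          gcongr
          · exact le_max_left _ _
          · exact hmono t x (hX0.trans h) htx
    · calc |R t| ≤ B := hB t ht h
        _ = B / Rt X * 1 * Rt X := by field_simp
        _ ≤ K * t ^ θ * Rt x := by
          gcongr
          · exact le_max_right _ _
          · exact Real.one_le_rpow ht hθ0.le
          · exact hmono X x hX0 hXx
  set Z : ℝ := ∑' n : ℕ, |z n| * (n : ℝ) ^ (-θ)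
  have hZ0 : 0 ≤ Z := tsum_nonneg fun n => by positivity
  have htail : ∀ j ∈ Finset.Icc 1 k, ∃ D : ℝ, 0 ≤ D ∧ ∀ x : ℝ, 1 ≤ x →
      |(∑' m : ℕ, z m * (m : ℝ) ^ (-(1 / (j : ℝ))) -
        ∑ m ∈ Finset.Icc 1 ⌊x⌋₊, z m * (m : ℝ) ^ (-(1 / (j : ℝ)))) *
          (r j * x ^ (1 / (j : ℝ)))| ≤ D * x ^ θ := by
    intro j hj
    obtain ⟨hj1, hjk⟩ := Finset.mem_Icc.1 hj
    have hj0 : (0 : ℝ) < j := by exact_mod_cast hj1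
    have hjk' : 1 / ((k : ℝ) + 1) < 1 / (j : ℝ) := by
      apply one_div_lt_one_div_of_lt hj0
      exact_mod_cast Nat.lt_succ_of_le hjk
    set σ : ℝ := min θ (1 / (j : ℝ))
    have hsum := hz σ (lt_min hθ hjk')
    set W : ℝ := ∑' n : ℕ, |z n| * (n : ℝ) ^ (-σ)
    have hW0 : 0 ≤ W := tsum_nonneg fun n => by positivity
    refine ⟨|r j| * W, by positivity, fun x hx => ?_⟩
    have hx0 : 0 < x := by linarith
    have h := abs_tsum_sub_sum_Icc_le (min_le_right θ (1 / (j : ℝ))) (by positivity) hsum hx0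
    rw [abs_mul, abs_mul (r j), abs_of_nonneg (Real.rpow_nonneg hx0.le _)]
    calc _ ≤ x ^ (σ - 1 / (j : ℝ)) * W * (|r j| * x ^ (1 / (j : ℝ))) := by gcongr
      _ = |r j| * W * (x ^ (σ - 1 / (j : ℝ)) * x ^ (1 / (j : ℝ))) := by ring
      _ = |r j| * W * x ^ σ := by rw [← Real.rpow_add hx0, sub_add_cancel]
      _ ≤ |r j| * W * x ^ θ := by
        gcongr
        exact min_le_left _ _
  choose! D hD0 hD using htail
  refine ⟨K * Z + (∑ j ∈ Finset.Icc 1 k, D j) / Rt X, eventually_atTop.2 ⟨X, fun x hx => ?_⟩⟩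
  have hx1 : 1 ≤ x := hX1.trans hx
  have hx0 : 0 < x := by linarith
  have hRx : 0 < Rt x := hpos x hx1
  rw [sum_convolution_sub_eq hT _ hx1, add_mul, add_mul]
  refine (abs_sub _ _).trans (add_le_add ?_ ?_)
  · calc _ ≤ ∑ m ∈ Finset.Icc 1 ⌊x⌋₊, |z m| * (m : ℝ) ^ (-θ) * (K * x ^ θ * Rt x) := by
          refine (Finset.abs_sum_le_sum_abs _ _).trans (Finset.sum_le_sum fun m hm => ?_)
          obtain ⟨hm1, hmx⟩ := Finset.mem_Icc.1 hm
          have hm1' : (1 : ℝ) ≤ m := by exact_mod_cast hm1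
          have hm0 : (0 : ℝ) < m := by linarith
          have hmx' : (m : ℝ) ≤ x := (Nat.le_floor_iff hx0.le).1 hmx
          have h := hRK x (x / m) hx ((one_le_div hm0).2 hmx') (div_le_self hx0.le hm1')
          rw [Real.div_rpow hx0.le hm0.le] at h
          rw [abs_mul, mul_assoc, Real.rpow_neg hm0.le]
          gcongr
          exact h.trans_eq (by ring)
      _ ≤ Z * (K * x ^ θ * Rt x) := by
          rw [← Finset.sum_mul]
          gcongr
          exact (hz θ hθ).sum_le_tsum _ fun n _ => by positivity
      _ = K * Z * x ^ θ * Rt x := by ring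
  · have hDs : 0 ≤ ∑ j ∈ Finset.Icc 1 k, D j := Finset.sum_nonneg hD0
    calc _ ≤ ∑ j ∈ Finset.Icc 1 k, D j * x ^ θ :=
          (Finset.abs_sum_le_sum_abs _ _).trans (Finset.sum_le_sum fun j hj => hD j hj x hx1)
      _ = (∑ j ∈ Finset.Icc 1 k, D j) / Rt X * x ^ θ * Rt X := by
          rw [← Finset.sum_mul]
          field_simp
      _ ≤ (∑ j ∈ Finset.Icc 1 k, D j) / Rt X * x ^ θ * Rt x := by
          gcongr
          exact hmono X x hX0 hx

/-- the convolution method.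
Let `y, z : ℕ → ℝ` with `Σ |y_n| n^{-σ} < ∞` for every `σ > 1` and
`Σ |z_n| n^{-σ} < ∞` for every `σ > 1/(k+1)`, and suppose
`Σ_{n ≤ x} y_n = Σ_{j=1}^k r_j x^{1/j} + R(x)` for all `x ≥ 1`.
Let `f = y ∗ z` and `G(x) = Σ_{j=1}^k (Σ_n z_n n^{-1/j}) r_j x^{1/j}`.
(a) If `R(x) ≪ 1` then `Σ_{n ≤ x} f(n) - G(x) ≪_ε x^{1/(k+1)+ε}` for every `ε > 0`.
(b) If `θ > 1/(k+1)` and `R̃ : [1,∞) → (0,∞)` is eventually increasing with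
`R(x) ≪ x^θ R̃(x)`, then `Σ_{n ≤ x} f(n) - G(x) ≪ x^θ R̃(x)`. -/
theorem stmt_4 (k : ℕ) (hk : 1 ≤ k) (y z : ℕ → ℝ)
    (hy : ∀ σ : ℝ, 1 < σ → Summable (fun n : ℕ => |y n| * (n : ℝ) ^ (-σ)))
    (hz : ∀ σ : ℝ, 1 / ((k : ℝ) + 1) < σ → Summable (fun n : ℕ => |z n| * (n : ℝ) ^ (-σ)))
    (r : ℕ → ℝ) (R : ℝ → ℝ)
    (hT : ∀ x : ℝ, 1 ≤ x →
      ∑ n ∈ Finset.Icc 1 ⌊x⌋₊, y n = ∑ j ∈ Finset.Icc 1 k, r j * x ^ (1 / (j : ℝ)) + R x)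
    (f : ℕ → ℝ) (hf : ∀ n : ℕ, f n = ∑ d ∈ n.divisors, y d * z (n / d))
    (G : ℝ → ℝ)
    (hG : ∀ x : ℝ, G x = ∑ j ∈ Finset.Icc 1 k,
      (∑' m : ℕ, z m * (m : ℝ) ^ (-(1 / (j : ℝ)))) * (r j * x ^ (1 / (j : ℝ)))) :
    ((∃ C : ℝ, ∀ᶠ x : ℝ in atTop, |R x| ≤ C) →
      ∀ ε : ℝ, 0 < ε → ∃ C : ℝ, ∀ᶠ x : ℝ in atTop,
        |∑ n ∈ Finset.Icc 1 ⌊x⌋₊, f n - G x| ≤ C * x ^ (1 / ((k : ℝ) + 1) + ε)) ∧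
    (∀ θ : ℝ, 1 / ((k : ℝ) + 1) < θ → ∀ Rt : ℝ → ℝ,
      (∀ x : ℝ, 1 ≤ x → 0 < Rt x) →
      (∃ x₀ : ℝ, ∀ x₁ x₂ : ℝ, x₀ ≤ x₁ → x₁ ≤ x₂ → Rt x₁ ≤ Rt x₂) →
      (∃ C : ℝ, ∀ᶠ x : ℝ in atTop, |R x| ≤ C * x ^ θ * Rt x) →
      ∃ C : ℝ, ∀ᶠ x : ℝ in atTop,
        |∑ n ∈ Finset.Icc 1 ⌊x⌋₊, f n - G x| ≤ C * x ^ θ * Rt x) := by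
  simp only [hf, hG]
  refine ⟨fun ⟨C, hC⟩ ε hε => ?_, fun θ hθ Rt hpos hmono hR =>
    exists_abs_sum_convolution_sub_le hz hT hθ hpos hmono hR⟩
  have h := exists_abs_sum_convolution_sub_le (θ := 1 / ((k : ℝ) + 1) + ε) (Rt := fun _ => 1)
    hz hT (by linarith) (fun _ _ => one_pos) ⟨0, fun _ _ _ _ => le_rfl⟩ ⟨|C|, ?_⟩
  · simpa only [mul_one] using h
  filter_upwards [hC, eventually_ge_atTop 1] with x hx hx1
  calc |R x| ≤ |C| * 1 * 1 := by simpa using hx.trans (le_abs_self C)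
    _ ≤ |C| * x ^ (1 / ((k : ℝ) + 1) + ε) * 1 := by
      gcongr
      exact Real.one_le_rpow hx1 (by positivity)
end

section
/- For every integer ℓ ≥ 1 there is a constant C_ℓ such that for all T ≥ 3, the number of distinct nontrivial zeros ρ = β + iγ of ζ with 0 < γ ≤ T that fail at least one of the following two conditions is at most C_ℓ · T: (i) ℓ/(2ℓ+1) < β < (ℓ+1)/(2ℓ+1); (ii) ζ(jρ/ℓ) ≠ 0 and ζ(j(1−ρ)/ℓ) ≠ 0 for every integer 1 ≤ j ≤ 2ℓ with j ≠ ℓ. -/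
open Complex

open MeasureTheory FourierTransform SchwartzMap in
/-- The Fourier transforms on `L¹` and on `L²` agree on `L¹ ∩ L²`. -/
theorem MeasureTheory.MemLp.fourier_toLp_ae_eq {g : ℝ → ℂ} (h₁ : Integrable g) (h₂ : MemLp g 2) :
    (𝓕 (h₂.toLp g) : Lp ℂ 2 (volume : Measure ℝ)) =ᵐ[volume] 𝓕 g := by
  have hcont : Continuous (𝓕 g) :=
    VectorFourier.fourierIntegral_continuous Real.continuous_fourierChar
      (by exact continuous_inner) h₁
  refine ae_eq_of_integral_contDiff_smul_eq
    ((Lp.memLp _).locallyIntegrable (by norm_num)) hcont.locallyIntegrable fun φ hφ hsupp ↦ ?_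
  have hs : HasCompactSupport (fun x ↦ (φ x : ℂ)) := hsupp.comp_left (g := ((↑) : ℝ → ℂ)) rfl
  let ψ : 𝓢(ℝ, ℂ) := hs.toSchwartzMap (Complex.ofRealCLM.contDiff.comp hφ)
  have hψ (x : ℝ) : ψ x = φ x := rfl
  have e := congrArg (fun D ↦ D ψ) (Lp.fourier_toTemperedDistribution_eq (h₂.toLp g))
  simp only [TemperedDistribution.fourier_apply, Lp.toTemperedDistribution_apply] at e
  simp only [hψ, smul_eq_mul] at e
  simp only [Complex.real_smul]
  rw [← e]
  have := VectorFourier.integral_fourierIntegral_smul_eq_flip (μ := volume) (ν := volume)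
    (L := innerₗ ℝ) Real.continuous_fourierChar continuous_inner ψ.integrable h₁
  simp only [flip_innerₗ, smul_eq_mul, hψ] at this
  refine Eq.trans ?_ this
  refine integral_congr_ae ?_
  filter_upwards [h₂.coeFn_toLp] with x hx
  rw [hx]; rfl

open MeasureTheory FourierTransform in
/-- Plancherel's theorem for the Fourier integral of a function in `L¹ ∩ L²`. -/
theorem integral_norm_sq_fourier_eq {g : ℝ → ℂ} (h₁ : Integrable g) (h₂ : MemLp g 2) :
    MemLp (𝓕 g) 2 ∧ ∫ t, ‖𝓕 g t‖ ^ 2 = ∫ t, ‖g t‖ ^ 2 := by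
  have hae := h₂.fourier_toLp_ae_eq h₁
  have hm : MemLp (𝓕 g) 2 := (memLp_congr_ae hae).1 (Lp.memLp _)
  refine ⟨hm, ?_⟩
  have hn : ∀ {f : ℝ → ℂ} (hf : MemLp f 2), ∫ t, ‖f t‖ ^ 2 = ‖hf.toLp f‖ ^ 2 := by
    intro f hf
    have := L2.inner_def (𝕜 := ℂ) (hf.toLp f) (hf.toLp f)
    rw [inner_self_eq_norm_sq_to_K] at this
    have h3 : ∫ t, (inner ℂ (hf.toLp f t) (hf.toLp f t) : ℂ) = ∫ t, ((‖f t‖ ^ 2 : ℝ) : ℂ) := by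
      refine integral_congr_ae ?_
      filter_upwards [hf.coeFn_toLp] with x hx
      rw [hx, inner_self_eq_norm_sq_to_K]; simp
    rw [h3, integral_complex_ofReal, ← RCLike.ofReal_pow] at this
    exact (Complex.ofReal_injective this).symm
  rw [hn hm, hn h₂, ← Lp.norm_fourier_eq (h₂.toLp g)]
  congr 2
  exact Lp.ext (hm.coeFn_toLp.trans hae.symm)

/-- The summatory function `∑_{1 ≤ n ≤ x} (-1)^(n-1)`. -/
noncomputable def altSum (x : ℝ) : ℝ := if Odd ⌊x⌋₊ then 1 else 0

lemma altSum_nonneg (x : ℝ) : 0 ≤ altSum x := by unfold altSum; split_ifs <;> simp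

lemma altSum_le_one (x : ℝ) : altSum x ≤ 1 := by unfold altSum; split_ifs <;> simp

lemma altSum_of_lt_one {x : ℝ} (hx : x < 1) : altSum x = 0 := by
  simp [altSum, Nat.floor_eq_zero.2 hx]

lemma measurable_altSum : Measurable altSum :=
  (measurable_from_top (f := fun n : ℕ ↦ if Odd n then (1 : ℝ) else 0)).comp Nat.measurable_floor

lemma sum_Icc_eq_altSum (x : ℝ) :
    ∑ k ∈ Finset.Icc 1 ⌊x⌋₊, (if Odd k then (1 : ℂ) else -1) = altSum x := by
  unfold altSum
  generalize ⌊x⌋₊ = n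
  induction n with
  | zero => simp
  | succ n ih =>
    rw [Finset.sum_Icc_succ_top (by omega), ih]
    by_cases h : Odd n <;> simp [h, Nat.odd_add_one]

/-- The Dirichlet eta function `∑ (-1)^(n-1) n^(-s)` on the half-plane `0 < re s`. -/
noncomputable def dirichletEta (s : ℂ) : ℂ := s * mellin (fun t ↦ (altSum t⁻¹ : ℂ)) s

lemma locallyIntegrable_altSum_inv :
    MeasureTheory.LocallyIntegrable (fun t : ℝ ↦ (altSum t⁻¹ : ℂ)) := by
  refine (MeasureTheory.locallyIntegrable_const (1 : ℝ)).mono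
    (Complex.measurable_ofReal.comp
      (measurable_altSum.comp measurable_inv)).aestronglyMeasurable (.of_forall fun t ↦ ?_)
  simpa [abs_of_nonneg (altSum_nonneg _)] using altSum_le_one _

open Asymptotics Filter Topology in
lemma altSum_inv_isBigO_atTop (a : ℝ) :
    (fun t : ℝ ↦ (altSum t⁻¹ : ℂ)) =O[atTop] (· ^ (-a)) := by
  refine (isBigO_zero _ _).congr' ?_ .rfl
  filter_upwards [eventually_gt_atTop 1] with t ht
  rw [altSum_of_lt_one (inv_lt_one_of_one_lt₀ ht), ofReal_zero]

open Asymptotics Filter Topology in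
lemma altSum_inv_isBigO_zero :
    (fun t : ℝ ↦ (altSum t⁻¹ : ℂ)) =O[𝓝[>] 0] (· ^ (-(0 : ℝ))) := by
  refine .of_bound 1 (.of_forall fun t ↦ ?_)
  simpa [abs_of_nonneg (altSum_nonneg _)] using altSum_le_one _

lemma mellinConvergent_altSum_inv {s : ℂ} (hs : 0 < s.re) :
    MellinConvergent (fun t ↦ (altSum t⁻¹ : ℂ)) s :=
  mellinConvergent_of_isBigO_rpow (locallyIntegrable_altSum_inv.locallyIntegrableOn _)
    (altSum_inv_isBigO_atTop (s.re + 1)) (by linarith) altSum_inv_isBigO_zero hs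

lemma differentiableAt_dirichletEta {s : ℂ} (hs : 0 < s.re) :
    DifferentiableAt ℂ dirichletEta s :=
  differentiableAt_id.mul <| mellin_differentiableAt_of_isBigO_rpow
    (locallyIntegrable_altSum_inv.locallyIntegrableOn _)
    (altSum_inv_isBigO_atTop (s.re + 1)) (by linarith) altSum_inv_isBigO_zero hs

lemma analyticOnNhd_dirichletEta : AnalyticOnNhd ℂ dirichletEta {s | 0 < s.re} :=
  DifferentiableOn.analyticOnNhd
    (fun _ hs ↦ (differentiableAt_dirichletEta hs).differentiableWithinAt)
    (isOpen_lt continuous_const continuous_re)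

open MeasureTheory Set in
lemma dirichletEta_eq_LSeries {s : ℂ} (hs : 1 < s.re) :
    dirichletEta s = LSeries (fun n ↦ if Odd n then 1 else -1) s := by
  rw [LSeries_eq_mul_integral' _ zero_le_one hs]
  · rw [dirichletEta, mellin_comp_inv (fun t ↦ (altSum t : ℂ)), mellin]
    congr 1
    simp_rw [sum_Icc_eq_altSum]
    rw [← integral_Ici_eq_integral_Ioi (x := (1 : ℝ)),
      ← setIntegral_eq_of_subset_of_forall_sdiff_eq_zero measurableSet_Ioi
        (show Ici (1 : ℝ) ⊆ Ioi 0 from fun x hx ↦ mem_Ioi.2 (zero_lt_one.trans_le hx))]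
    · refine setIntegral_congr_fun measurableSet_Ioi fun x _ ↦ ?_
      simp only [smul_eq_mul]
      rw [mul_comm, neg_add']
    · rintro x ⟨_, hx⟩
      simp [altSum_of_lt_one (not_le.1 hx)]
  · refine .of_bound 1 (.of_forall fun n ↦ ?_)
    have (k : ℕ) : ‖(if Odd k then (1 : ℂ) else -1)‖ = 1 := by split_ifs <;> simp
    simp [this]

lemma norm_LSeries_term_alt (s : ℂ) (n : ℕ) :
    ‖LSeries.term (fun n ↦ if Odd n then 1 else -1) s n‖ = ‖LSeries.term 1 s n‖ := by
  simp only [LSeries.norm_term_eq, Pi.one_apply]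
  congr 2
  split_ifs <;> simp

lemma LSeriesSummable_alt {s : ℂ} (hs : 1 < s.re) :
    LSeriesSummable (fun n ↦ if Odd n then 1 else -1) s := by
  refine Summable.of_norm ?_
  simp_rw [norm_LSeries_term_alt]
  exact (LSeriesSummable_one_iff.2 hs).norm

lemma LSeries_alt_eq {s : ℂ} (hs : 1 < s.re) :
    LSeries (fun n ↦ if Odd n then 1 else -1) s = (1 - 2 ^ (1 - s)) * riemannZeta s := by
  have h1 := LSeriesSummable_one_iff.2 hs
  have hb := LSeriesSummable_alt hs
  rw [← LSeries_one_eq_riemannZeta hs, sub_mul, one_mul]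
  suffices h : LSeries (fun n ↦ if Odd n then 1 else -1) s - LSeries 1 s =
      -(2 ^ (1 - s) * LSeries 1 s) by linear_combination h
  have e (k : ℕ) : LSeries.term (fun n ↦ if Odd n then 1 else -1) s (2 * k) -
      LSeries.term 1 s (2 * k) = -(2 ^ (1 - s) * LSeries.term 1 s k) := by
    rcases eq_or_ne k 0 with rfl | hk
    · simp
    have : (2 : ℂ) ^ (1 - s) = 2 / 2 ^ s := by rw [cpow_sub _ _ two_ne_zero, cpow_one]
    rw [LSeries.term_of_ne_zero (by simpa), LSeries.term_of_ne_zero (by simpa),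
      LSeries.term_of_ne_zero hk, this]
    have h2 : ((2 * k : ℕ) : ℂ) ^ s = 2 ^ s * (k : ℂ) ^ s := by
      exact_mod_cast natCast_mul_natCast_cpow 2 k s
    simp only [Pi.one_apply, h2, show ¬ Odd (2 * k) by simp, if_false]
    field_simp
    ring
  have o (k : ℕ) : LSeries.term (fun n ↦ if Odd n then 1 else -1) s (2 * k + 1) -
      LSeries.term 1 s (2 * k + 1) = 0 := by
    simp [LSeries.term_of_ne_zero]
  rw [LSeries, LSeries, ← hb.tsum_sub h1]
  have he := (h1.mul_left (2 ^ (1 - s))).neg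
  rw [← tsum_even_add_odd (by simp_rw [e]; exact he) (by simp_rw [o]; exact summable_zero)]
  simp_rw [e, o, tsum_zero, add_zero]
  rw [tsum_neg, tsum_mul_left]

lemma dirichletEta_eq_riemannZeta {s : ℂ} (hs : 0 < s.re) (hi : s.im ≠ 0) :
    dirichletEta s = (1 - 2 ^ (1 - s)) * riemannZeta s := by
  have key (ε : ℝ) (hε : ε ≠ 0) : Set.EqOn dirichletEta
      (fun s ↦ (1 - 2 ^ (1 - s)) * riemannZeta s) {s | 0 < s.re ∧ 0 < ε * s.im} := by
    have hopen : IsOpen {s : ℂ | 0 < s.re ∧ 0 < ε * s.im} :=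
      (isOpen_lt continuous_const continuous_re).inter
        (isOpen_lt continuous_const (continuous_const.mul continuous_im))
    have hconv : Convex ℝ {s : ℂ | 0 < s.re ∧ 0 < ε * s.im} :=
      (convex_halfSpace_gt (f := re) reLm.isLinear 0).inter
        (convex_halfSpace_gt (f := fun z : ℂ ↦ ε * z.im) (ε • imLm).isLinear 0)
    have h0 : (⟨2, ε⟩ : ℂ) ∈ {s : ℂ | 0 < s.re ∧ 0 < ε * s.im} :=
      ⟨two_pos, mul_self_pos.2 hε⟩
    refine (analyticOnNhd_dirichletEta.mono fun _ h ↦ h.1).eqOn_of_preconnected_of_eventuallyEq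
      (DifferentiableOn.analyticOnNhd (fun z hz ↦ ?_) hopen) hconv.isPreconnected h0 ?_
    · have hz1 : z ≠ 1 := by rintro rfl; simp at hz
      refine DifferentiableAt.differentiableWithinAt ?_
      refine DifferentiableAt.mul ?_ (differentiableAt_riemannZeta hz1)
      exact (differentiableAt_const _).sub
        (((differentiableAt_const _).sub differentiableAt_id).const_cpow (.inl two_ne_zero))
    · filter_upwards [(isOpen_lt continuous_const continuous_re).mem_nhds
        (show (1 : ℝ) < (⟨2, ε⟩ : ℂ).re by norm_num)] with z hz
      rw [dirichletEta_eq_LSeries hz, LSeries_alt_eq hz]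
  exact key s.im hi ⟨hs, mul_self_pos.2 hi⟩

lemma norm_dirichletEta_two_add_ge (t : ℝ) : 1 / 4 ≤ ‖dirichletEta (2 + t * I)‖ := by
  have hs : 1 < (2 + t * I : ℂ).re := by simp
  have hb := LSeriesSummable_alt hs
  have hz := hasSum_zeta_two
  have hn (n : ℕ) : ‖LSeries.term (fun n ↦ if Odd n then 1 else -1) (2 + t * I) n‖ =
      1 / (n : ℝ) ^ 2 := by
    rw [norm_LSeries_term_alt, LSeries.norm_term_eq]
    rcases eq_or_ne n 0 with rfl | h
    · simp
    · simp [h]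
  rw [dirichletEta_eq_LSeries hs, LSeries, ← hb.sum_add_tsum_nat_add 2]
  have h1 := hz.summable.sum_add_tsum_nat_add 2
  rw [hz.tsum_eq] at h1
  have h2 : ‖∑' n, LSeries.term (fun n ↦ if Odd n then 1 else -1) (2 + t * I) (n + 2)‖ ≤
      ∑' n : ℕ, 1 / ((n + 2 : ℕ) : ℝ) ^ 2 := by
    simp_rw [← hn]
    exact norm_tsum_le_tsum_norm ((summable_nat_add_iff 2).2 hb.norm)
  simp only [Finset.sum_range_succ, Finset.sum_range_zero, LSeries.term_of_ne_zero one_ne_zero,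
    LSeries.term_zero] at h1 ⊢
  norm_num at h1 ⊢
  have h3 := norm_sub_le_norm_add (1 : ℂ)
    (∑' n, LSeries.term (fun n ↦ if Odd n then 1 else -1) (2 + t * I) (n + 2))
  have := Real.pi_lt_d2
  have := Real.pi_pos
  norm_num at h2 h3
  nlinarith

lemma norm_sq_le_norm_exp_sub_one_sq {z : ℂ} (hre : 0 ≤ z.re) (him : |z.im| ≤ 1) :
    ‖z‖ ^ 2 / 4 ≤ ‖exp z - 1‖ ^ 2 := by
  have hexp := Real.add_one_le_exp z.re
  have hcos := Real.cos_le_one_sub_mul_cos_sq (him.trans (by linarith [Real.pi_gt_three]))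
  have hpi : 1 / 8 ≤ 2 / Real.pi ^ 2 := by
    rw [div_le_div_iff₀ (by norm_num) (by positivity)]
    nlinarith [Real.pi_lt_four, Real.pi_pos]
  have h1 : 1 / 8 * z.im ^ 2 ≤ 1 - Real.cos z.im := by
    nlinarith [mul_le_mul_of_nonneg_right hpi (sq_nonneg z.im)]
  rw [Complex.sq_norm, Complex.sq_norm, normSq_apply, normSq_apply]
  simp only [sub_re, sub_im, exp_re, exp_im, one_re, one_im]
  have h2 : (Real.exp z.re * Real.cos z.im - 1) * (Real.exp z.re * Real.cos z.im - 1) +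
      (Real.exp z.re * Real.sin z.im - 0) * (Real.exp z.re * Real.sin z.im - 0) =
      (Real.exp z.re - 1) ^ 2 + 2 * Real.exp z.re * (1 - Real.cos z.im) := by
    linear_combination Real.exp z.re ^ 2 * Real.sin_sq_add_cos_sq z.im
  rw [h2]
  nlinarith [mul_nonneg hre (sub_nonneg.2 hexp), sq_nonneg z.im,
    mul_le_mul_of_nonneg_right (show 1 ≤ Real.exp z.re by linarith)
      (show 0 ≤ 1 - Real.cos z.im by nlinarith [sq_nonneg z.im])]

lemma abs_altSum_sub_le_one (x y : ℝ) : |altSum x - altSum y| ≤ 1 :=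
  abs_sub_le_iff.2 ⟨by linarith [altSum_le_one x, altSum_nonneg y],
    by linarith [altSum_le_one y, altSum_nonneg x]⟩

/-- The weighted increment of the summatory function on the logarithmic scale. -/
noncomputable def altIncr (σ h u : ℝ) : ℂ :=
  ((Real.exp (-σ * u) * (altSum (Real.exp (h + u)) - altSum (Real.exp u)) : ℝ) : ℂ)

lemma measurable_altIncr (σ h : ℝ) : Measurable (altIncr σ h) := by
  have := measurable_altSum
  unfold altIncr
  fun_prop

lemma norm_altIncr (σ h u : ℝ) : ‖altIncr σ h u‖ =
    Real.exp (-σ * u) * |altSum (Real.exp (h + u)) - altSum (Real.exp u)| := by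
  rw [altIncr, norm_real, Real.norm_eq_abs, abs_mul, abs_of_pos (Real.exp_pos _)]

lemma norm_altIncr_le {σ h : ℝ} (hh : 0 ≤ h) (u : ℝ) :
    ‖altIncr σ h u‖ ≤ (Set.Ici (-h)).indicator (fun u ↦ Real.exp (-σ * u)) u := by
  rw [norm_altIncr]
  by_cases hu : u ∈ Set.Ici (-h)
  · rw [Set.indicator_of_mem hu]
    exact mul_le_of_le_one_right (Real.exp_pos _).le (abs_altSum_sub_le_one _ _)
  · rw [Set.indicator_of_notMem hu]
    rw [Set.mem_Ici, not_le] at hu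
    rw [altSum_of_lt_one (Real.exp_lt_one_iff.2 (by linarith)),
      altSum_of_lt_one (Real.exp_lt_one_iff.2 (by linarith))]
    simp

open MeasureTheory in
lemma integrable_indicator_exp {σ : ℝ} (hσ : 0 < σ) (h : ℝ) :
    Integrable ((Set.Ici h).indicator (fun u ↦ Real.exp (-σ * u))) :=
  (integrable_indicator_iff measurableSet_Ici).2
    ((integrableOn_Ici_iff_integrableOn_Ioi (by simp)).2 (integrableOn_exp_mul_Ioi (by linarith) _))

open MeasureTheory in
lemma integrable_altIncr {σ h : ℝ} (hσ : 0 < σ) (hh : 0 ≤ h) : Integrable (altIncr σ h) :=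
  (integrable_indicator_exp hσ (-h)).mono' (measurable_altIncr σ h).aestronglyMeasurable
    (.of_forall (norm_altIncr_le hh))

open MeasureTheory in
lemma memLp_altIncr {σ h : ℝ} (hσ : 0 < σ) (hh : 0 ≤ h) : MemLp (altIncr σ h) 2 := by
  rw [memLp_two_iff_integrable_sq_norm (measurable_altIncr σ h).aestronglyMeasurable]
  refine (integrable_indicator_exp (mul_pos two_pos hσ) (-h)).mono'
    ((measurable_altIncr σ h).norm.pow_const 2).aestronglyMeasurable (.of_forall fun u ↦ ?_)
  rw [Real.norm_of_nonneg (by positivity)]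
  refine (pow_le_pow_left₀ (norm_nonneg _) (norm_altIncr_le hh u) 2).trans_eq ?_
  by_cases hu : u ∈ Set.Ici (-h)
  · rw [Set.indicator_of_mem hu, Set.indicator_of_mem hu, ← Real.exp_nat_mul]
    ring_nf
  · rw [Set.indicator_of_notMem hu, Set.indicator_of_notMem hu, zero_pow two_ne_zero]

lemma exists_natCast_mem_Ioc_of_altSum_ne {x y : ℝ} (hxy : x ≤ y) (hx : 0 ≤ x)
    (h : altSum y ≠ altSum x) : ∃ n : ℕ, x < (n + 1 : ℕ) ∧ ((n + 1 : ℕ) : ℝ) ≤ y := by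
  have hlt : ⌊x⌋₊ < ⌊y⌋₊ := (Nat.floor_mono hxy).lt_of_ne fun e ↦ h (by rw [altSum, altSum, e])
  exact ⟨⌊x⌋₊, by exact_mod_cast Nat.lt_floor_add_one x,
    (Nat.le_floor_iff (hx.trans hxy)).1 hlt⟩

open scoped ENNReal in
lemma ofReal_norm_altIncr_sq_le {σ h : ℝ} (hh : 0 ≤ h) (u : ℝ) :
    ENNReal.ofReal (‖altIncr σ h u‖ ^ 2) ≤
      ∑' n : ℕ, (Set.Ico (Real.log (n + 1 : ℕ) - h) (Real.log (n + 1 : ℕ))).indicator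
        (fun u ↦ ENNReal.ofReal (Real.exp (-(2 * σ) * u))) u := by
  by_cases he : altSum (Real.exp (h + u)) = altSum (Real.exp u)
  · simp [norm_altIncr, he]
  obtain ⟨n, h1, h2⟩ := exists_natCast_mem_Ioc_of_altSum_ne
    (Real.exp_le_exp.2 (by linarith)) (Real.exp_pos _).le he
  have hn : (0 : ℝ) < (n + 1 : ℕ) := by positivity
  have hu : u ∈ Set.Ico (Real.log (n + 1 : ℕ) - h) (Real.log (n + 1 : ℕ)) :=
    ⟨by linarith [(Real.log_le_iff_le_exp hn).2 h2], (Real.lt_log_iff_exp_lt hn).2 h1⟩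
  refine le_trans ?_ (ENNReal.le_tsum n)
  rw [Set.indicator_of_mem hu, norm_altIncr, mul_pow, ← Real.exp_nat_mul]
  refine ENNReal.ofReal_le_ofReal ((mul_le_of_le_one_right (Real.exp_pos _).le
    (pow_le_one₀ (abs_nonneg _) (abs_altSum_sub_le_one _ _))).trans_eq ?_)
  ring_nf

open MeasureTheory in
lemma integral_norm_altIncr_sq_le {σ₀ σ h : ℝ} (hσ₀ : 1 / 2 < σ₀) (hσ : σ₀ ≤ σ) (hσ' : σ ≤ 4)
    (hh : 0 ≤ h) (hh' : h ≤ 1) : ∫ u, ‖altIncr σ h u‖ ^ 2 ≤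
      h * (Real.exp 8 * ∑' n : ℕ, ((n + 1 : ℕ) : ℝ) ^ (-(2 * σ₀))) := by
  have hsum : Summable fun n : ℕ ↦ ((n + 1 : ℕ) : ℝ) ^ (-(2 * σ₀)) :=
    (summable_nat_add_iff 1).2 (Real.summable_nat_rpow.2 (by linarith))
  have hnn (n : ℕ) : 0 ≤ h * (Real.exp 8 * ((n + 1 : ℕ) : ℝ) ^ (-(2 * σ₀))) := by positivity
  rw [integral_eq_lintegral_of_nonneg_ae (.of_forall fun u ↦ by positivity)
    ((measurable_altIncr σ h).norm.pow_const 2).aestronglyMeasurable]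
  refine ENNReal.toReal_le_of_le_ofReal
    (mul_nonneg hh (mul_nonneg (Real.exp_pos _).le (tsum_nonneg fun n ↦ by positivity))) ?_
  rw [← tsum_mul_left, ← tsum_mul_left, ENNReal.ofReal_tsum_of_nonneg hnn
    ((hsum.mul_left _).mul_left _)]
  refine (lintegral_mono (ofReal_norm_altIncr_sq_le hh)).trans ?_
  rw [lintegral_tsum fun n ↦ ((by fun_prop : Measurable fun u : ℝ ↦
    ENNReal.ofReal (Real.exp (-(2 * σ) * u))).indicator measurableSet_Ico).aemeasurable]
  refine ENNReal.tsum_le_tsum fun n ↦ ?_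
  have hn : (1 : ℝ) ≤ (n + 1 : ℕ) := by simp
  have hlog := Real.log_nonneg hn
  rw [lintegral_indicator measurableSet_Ico]
  refine (setLIntegral_mono (g := fun _ ↦
    ENNReal.ofReal (Real.exp 8 * ((n + 1 : ℕ) : ℝ) ^ (-(2 * σ₀)))) measurable_const
    fun u hu ↦ ENNReal.ofReal_le_ofReal ?_).trans_eq ?_
  · rw [Real.rpow_def_of_pos (by linarith), ← Real.exp_add]
    refine Real.exp_le_exp.2 ?_
    nlinarith [mul_le_mul_of_nonneg_left hu.1 (show 0 ≤ 2 * σ by linarith),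
      mul_nonneg hlog (sub_nonneg.2 hσ), mul_le_mul hσ' hh' hh (by norm_num : (0 : ℝ) ≤ 4)]
  · rw [setLIntegral_const, Real.volume_Ico, sub_sub_cancel, ← ENNReal.ofReal_mul (by positivity),
      mul_comm]

open FourierTransform in
lemma exp_sub_one_mul_mellin_eq_fourier {s : ℂ} (hs : 0 < s.re) (h : ℝ) :
    (exp (h * s) - 1) * mellin (fun t ↦ (altSum t⁻¹ : ℂ)) s =
      𝓕 (altIncr s.re h) (s.im / (2 * Real.pi)) := by
  set f : ℝ → ℂ := fun t ↦ (altSum t⁻¹ : ℂ) with hf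
  have hc : MellinConvergent f s := mellinConvergent_altSum_inv hs
  have hpos := Real.exp_pos (-h)
  have e1 : mellin (fun t ↦ f (Real.exp (-h) * t)) s = exp (h * s) * mellin f s := by
    rw [mellin_comp_mul_left f s hpos, smul_eq_mul, cpow_def_of_ne_zero (by simp),
      ← ofReal_log hpos.le, Real.log_exp]
    push_cast
    ring_nf
  have e2 := (hasMellin_sub ((MellinConvergent.comp_mul_left hpos).2 hc) hc).2
  rw [sub_mul, one_mul, ← e1, ← e2, mellin_eq_fourier]
  refine congrArg (fun g : ℝ → ℂ ↦ 𝓕 g (s.im / (2 * Real.pi))) (funext fun u ↦ ?_)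
  simp only [hf, altIncr, ← Real.exp_neg, neg_neg, ← Real.exp_add, Complex.real_smul]
  push_cast
  ring_nf

open MeasureTheory FourierTransform in
/-- The mean square of the Dirichlet eta function on vertical segments right of `re s = 1 / 2`. -/
theorem exists_integral_norm_dirichletEta_sq_le {σ₀ : ℝ} (hσ₀ : 1 / 2 < σ₀) :
    ∃ C : ℝ, ∀ σ T : ℝ, σ₀ ≤ σ → σ ≤ 4 → 1 ≤ T →
      ∫ t in -T..T, ‖dirichletEta (σ + t * I)‖ ^ 2 ≤ C * T := by
  set B := Real.exp 8 * ∑' n : ℕ, ((n + 1 : ℕ) : ℝ) ^ (-(2 * σ₀))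
  refine ⟨4 * (2 * Real.pi * B), fun σ T hσ hσ' hT ↦ ?_⟩
  have hT0 : 0 < T := by linarith
  have hσ0 : 0 < σ := by linarith
  have hh : 0 ≤ T⁻¹ := by positivity
  obtain ⟨hL2, hP⟩ := integral_norm_sq_fourier_eq (integrable_altIncr hσ0 hh)
    (memLp_altIncr hσ0 hh)
  have hint : Integrable fun t ↦ 4 * T ^ 2 * ‖𝓕 (altIncr σ T⁻¹) (t / (2 * Real.pi))‖ ^ 2 :=
    (((memLp_two_iff_integrable_sq_norm hL2.1).1 hL2).comp_div (by positivity)).const_mul _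
  have hcont : Continuous fun t : ℝ ↦ ‖dirichletEta (σ + t * I)‖ ^ 2 := by
    refine (continuous_iff_continuousAt.2 fun t ↦ ?_).norm.pow 2
    exact ContinuousAt.comp (f := fun t : ℝ ↦ (σ + t * I : ℂ))
      (differentiableAt_dirichletEta (by simpa)).continuousAt (by fun_prop)
  have hpt (t : ℝ) (ht : t ∈ Set.Icc (-T) T) : ‖dirichletEta (σ + t * I)‖ ^ 2 ≤
      4 * T ^ 2 * ‖𝓕 (altIncr σ T⁻¹) (t / (2 * Real.pi))‖ ^ 2 := by
    have hs : 0 < (σ + t * I : ℂ).re := by simpa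
    have e := exp_sub_one_mul_mellin_eq_fourier hs T⁻¹
    have hb : ‖((T⁻¹ : ℝ) : ℂ) * (σ + t * I)‖ ^ 2 / 4 ≤
        ‖exp (((T⁻¹ : ℝ) : ℂ) * (σ + t * I)) - 1‖ ^ 2 := by
      refine norm_sq_le_norm_exp_sub_one_sq ?_ ?_
      · rw [re_ofReal_mul]; positivity
      · rw [im_ofReal_mul]
        simp only [add_im, ofReal_im, mul_im, ofReal_re, I_im, mul_one, I_re, mul_zero, add_zero,
          zero_add]
        rw [abs_mul, abs_of_nonneg hh, inv_mul_le_one₀ hT0]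
        exact abs_le.2 ht
    simp only [add_re, ofReal_re, mul_re, I_re, mul_zero, ofReal_im, I_im, sub_self, add_zero,
      add_im, mul_im, mul_one, zero_add] at e
    rw [← e, dirichletEta, norm_mul, norm_mul, mul_pow, mul_pow, ← mul_assoc]
    refine mul_le_mul_of_nonneg_right ?_ (by positivity)
    rw [norm_mul, mul_pow, norm_real, Real.norm_of_nonneg hh] at hb
    calc ‖(σ + t * I : ℂ)‖ ^ 2 = 4 * T ^ 2 * (T⁻¹ ^ 2 * ‖(σ + t * I : ℂ)‖ ^ 2 / 4) := by
          field_simp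
      _ ≤ _ := mul_le_mul_of_nonneg_left hb (by positivity)
  calc ∫ t in -T..T, ‖dirichletEta (σ + t * I)‖ ^ 2
      ≤ ∫ t in -T..T, 4 * T ^ 2 * ‖𝓕 (altIncr σ T⁻¹) (t / (2 * Real.pi))‖ ^ 2 :=
        intervalIntegral.integral_mono_on (by linarith) (hcont.intervalIntegrable _ _)
          hint.intervalIntegrable hpt
    _ ≤ ∫ t, 4 * T ^ 2 * ‖𝓕 (altIncr σ T⁻¹) (t / (2 * Real.pi))‖ ^ 2 := by
        rw [intervalIntegral.integral_of_le (by linarith)]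
        exact setIntegral_le_integral hint (.of_forall fun t ↦ by positivity)
    _ = 4 * T ^ 2 * (2 * Real.pi * ∫ u, ‖altIncr σ T⁻¹ u‖ ^ 2) := by
        rw [integral_const_mul, Measure.integral_comp_div
          (fun t ↦ ‖𝓕 (altIncr σ T⁻¹) t‖ ^ 2), hP, smul_eq_mul, abs_of_pos (by positivity)]
    _ ≤ 4 * T ^ 2 * (2 * Real.pi * (T⁻¹ * B)) := by
        gcongr
        exact integral_norm_altIncr_sq_le hσ₀ hσ hσ' hh (inv_le_one_of_one_le₀ hT)
    _ = 4 * (2 * Real.pi * B) * T := by field_simp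

open Metric MeromorphicOn in
/-- Jensen's inequality for a finite set of zeros. -/
lemma card_mul_log_add_log_norm_le_circleAverage {f : ℂ → ℂ} {c : ℂ} {r R : ℝ} (hr : 0 < r)
    (hrR : r < R) (hf : AnalyticOnNhd ℂ f (closedBall c R)) (hc : f c ≠ 0) (S : Finset ℂ)
    (hS : ∀ z ∈ S, f z = 0 ∧ z ∈ closedBall c r) :
    S.card * Real.log (R / r) + Real.log ‖f c‖ ≤
      Real.circleAverage (fun z ↦ Real.log ‖f z‖) c R := by
  have hR : 0 < R := hr.trans hrR
  have hf' : AnalyticOnNhd ℂ f (closedBall c |R|) := by rwa [abs_of_pos hR]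
  rw [hf'.circleAverage_log_norm hR.ne' hc, abs_of_pos hR]
  gcongr
  set D := divisor f (closedBall c R) with hD
  have hfin : (Function.support fun u ↦ (D u : ℝ) * Real.log (R * ‖c - u‖⁻¹)).Finite :=
    (D.finiteSupport (isCompact_closedBall ..)).subset fun _ _ ↦ by simp_all
  have hnonneg (u : ℂ) : 0 ≤ (D u : ℝ) * Real.log (R * ‖c - u‖⁻¹) := by
    by_cases hu : u ∈ closedBall c R
    · refine mul_nonneg (mod_cast hf.divisor_nonneg u) ?_
      rcases eq_or_ne u c with rfl | huc
      · simp
      have : 0 < ‖c - u‖ := norm_pos_iff.2 (sub_ne_zero.2 huc.symm)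
      refine Real.log_nonneg ?_
      rw [← div_eq_mul_inv, one_le_div this, ← dist_eq_norm']
      exact hu
    · simp [hD, Function.locallyFinsuppWithin.apply_eq_zero_of_notMem _ hu]
  rw [finsum_eq_sum_of_support_subset (s := hfin.toFinset ∪ S) _
    (fun u hu ↦ Finset.mem_coe.2 (Finset.mem_union_left _ (hfin.mem_toFinset.2 hu)))]
  refine le_trans ?_ (Finset.sum_le_sum_of_subset_of_nonneg Finset.subset_union_right
    fun u _ _ ↦ hnonneg u)
  rw [← nsmul_eq_mul]
  refine Finset.card_nsmul_le_sum _ _ _ fun u hu ↦ ?_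
  obtain ⟨hfu, hur⟩ := hS u hu
  have huR : u ∈ closedBall c R := closedBall_subset_closedBall hrR.le hur
  have hcR : c ∈ closedBall c R := mem_closedBall_self hR.le
  have htop : analyticOrderAt f u ≠ ⊤ :=
    hf.analyticOrderAt_ne_top_of_isPreconnected isPreconnected_closedBall hcR huR
      (by simp [(hf c hcR).analyticOrderAt_eq_zero.2 hc])
  have hone : (1 : ℝ) ≤ D u := by
    have h0 := (hf u huR).analyticOrderAt_ne_zero.2 hfu
    rw [hD, hf.divisor_apply huR]
    obtain ⟨n, hn⟩ := ENat.ne_top_iff_exists.1 htop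
    rw [← hn] at h0 ⊢
    simp only [ENat.map_natCast, WithTop.untop₀_coe, Int.cast_natCast]
    exact_mod_cast Nat.one_le_iff_ne_zero.2 (by exact_mod_cast h0)
  have hcu : 0 < ‖c - u‖ := norm_pos_iff.2 (sub_ne_zero.2 fun h ↦ hc (h ▸ hfu))
  have hle : ‖c - u‖ ≤ r := by rw [← dist_eq_norm']; exact hur
  have h1 : 0 < Real.log (R / r) := Real.log_pos ((one_lt_div hr).2 hrR)
  have h2 : Real.log (R / r) ≤ Real.log (R * ‖c - u‖⁻¹) := by
    rw [← div_eq_mul_inv]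
    gcongr
  nlinarith

lemma Real.log_le_sq {x : ℝ} (hx : 0 ≤ x) : Real.log x ≤ x ^ 2 := by
  rcases hx.eq_or_lt with rfl | h
  · simp
  · nlinarith [Real.log_le_sub_one_of_pos h, sq_nonneg (x - 1)]

lemma circleMap_two_add (t R θ : ℝ) : circleMap (2 + t * I) R θ =
    ((2 + R * Real.cos θ : ℝ) : ℂ) + ((t + R * Real.sin θ : ℝ) : ℂ) * I := by
  rw [circleMap, exp_mul_I]
  push_cast
  ring

attribute [irreducible] dirichletEta

lemma continuous_dirichletEta_comp {X : Type*} [TopologicalSpace X] {f : X → ℂ}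
    (hf : Continuous f) (h : ∀ x, 0 < (f x).re) : Continuous fun x ↦ dirichletEta (f x) :=
  continuous_iff_continuousAt.2 fun x ↦
    (differentiableAt_dirichletEta (h x)).continuousAt.comp hf.continuousAt

lemma continuous_norm_sq_dirichletEta_circleMap {R : ℝ} (hR : 0 ≤ R) (hR' : R < 2) :
    Continuous fun p : ℝ × ℝ ↦ ‖dirichletEta (circleMap (2 + p.1 * I) R p.2)‖ ^ 2 := by
  have h : Continuous fun p : ℝ × ℝ ↦ dirichletEta (circleMap (2 + p.1 * I) R p.2) := by
    refine continuous_dirichletEta_comp ?_ fun p ↦ ?_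
    · simp_rw [circleMap_two_add]
      fun_prop
    · rw [circleMap_two_add]
      simp only [add_re, ofReal_re, mul_re, I_re, mul_zero, ofReal_im, I_im, mul_one, sub_self,
        add_zero]
      nlinarith [Real.neg_one_le_cos p.2]
  exact h.norm.fun_pow 2

open MeasureTheory in
lemma integral_circleAverage_dirichletEta_sq_le {R C T : ℝ} (hR : 0 ≤ R) (hR' : R < 2)
    (hT : 0 ≤ T)
    (hC : ∀ σ : ℝ, 2 - R ≤ σ → σ ≤ 4 →
      ∫ t in -(T + 2)..(T + 2), ‖dirichletEta (σ + t * I)‖ ^ 2 ≤ C) :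
    ∫ t in -T..T, Real.circleAverage (fun z ↦ ‖dirichletEta z‖ ^ 2) (2 + t * I) R ≤ C := by
  have hcont := continuous_norm_sq_dirichletEta_circleMap hR hR'
  simp only [Real.circleAverage, smul_eq_mul]
  rw [intervalIntegral.integral_const_mul, intervalIntegral_intervalIntegral_swap]
  · rw [inv_mul_le_iff₀ Real.two_pi_pos]
    have hcont' : Continuous fun θ : ℝ ↦ ∫ t in -T..T,
        ‖dirichletEta (circleMap (2 + t * I) R θ)‖ ^ 2 :=
      intervalIntegral.continuous_parametric_intervalIntegral_of_continuous'
        (f := fun θ t ↦ ‖dirichletEta (circleMap (2 + t * I) R θ)‖ ^ 2)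
        (hcont.comp continuous_swap) _ _
    have hb : ∀ θ : ℝ, ∫ t in -T..T, ‖dirichletEta (circleMap (2 + t * I) R θ)‖ ^ 2 ≤ C := by
      intro θ
      have hcos : |R * Real.cos θ| ≤ R := by
        rw [abs_mul, abs_of_nonneg hR]
        exact mul_le_of_le_one_right hR (Real.abs_cos_le_one θ)
      have hsin : |R * Real.sin θ| ≤ R := by
        rw [abs_mul, abs_of_nonneg hR]
        exact mul_le_of_le_one_right hR (Real.abs_sin_le_one θ)
      rw [abs_le] at hcos hsin
      refine le_trans ?_ (hC (2 + R * Real.cos θ) (by linarith) (by linarith))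
      simp_rw [circleMap_two_add]
      rw [intervalIntegral.integral_comp_add_right (fun x : ℝ ↦
        ‖dirichletEta (((2 + R * Real.cos θ : ℝ) : ℂ) + (x : ℂ) * I)‖ ^ 2)]
      refine intervalIntegral.integral_mono_interval (by linarith) (by linarith) (by linarith)
        (.of_forall fun x ↦ by positivity) (Continuous.intervalIntegrable ?_ _ _)
      refine (continuous_dirichletEta_comp (by fun_prop) fun t ↦ ?_).norm.fun_pow 2
      simp only [add_re, ofReal_re, mul_re, I_re, mul_zero, ofReal_im, I_im, mul_one, sub_self,
        add_zero]
      linarith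
    calc ∫ θ in 0..2 * Real.pi, ∫ t in -T..T, ‖dirichletEta (circleMap (2 + t * I) R θ)‖ ^ 2
        ≤ ∫ θ in 0..2 * Real.pi, C :=
          intervalIntegral.integral_mono_on Real.two_pi_pos.le (hcont'.intervalIntegrable _ _)
            intervalIntegrable_const fun θ _ ↦ hb θ
      _ = 2 * Real.pi * C := by simp
  · exact (hcont.continuousOn.integrableOn_compact
      (isCompact_uIcc.prod isCompact_uIcc)).mono_set
        (Set.prod_mono Set.uIoc_subset_uIcc Set.uIoc_subset_uIcc)

open MeasureTheory in
/-- The Bohr–Landau zero-density bound for the Dirichlet eta function. -/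
theorem exists_card_dirichletEta_zeros_le {σ : ℝ} (hσ : 1 / 2 < σ) (hσ' : σ ≤ 1) :
    ∃ C : ℝ, ∀ T : ℝ, 1 ≤ T → ∀ S : Finset ℂ,
      (∀ z ∈ S, dirichletEta z = 0 ∧ σ ≤ z.re ∧ z.re ≤ 1 ∧ |z.im| ≤ T) → S.card ≤ C * T := by
  set δ := (σ - 1 / 2) / 4 with hδ
  have hδ0 : 0 < δ := by linarith
  set r := 2 - σ + δ
  set R := r + δ
  have hr : 0 < r := by linarith
  have hrR : r < R := by linarith
  have hR : 0 ≤ R := by linarith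
  have hR' : R < 2 := by linarith
  obtain ⟨C, hC⟩ := exists_integral_norm_dirichletEta_sq_le (show 1 / 2 < 2 - R by linarith)
  set L := Real.log (R / r)
  have hL : 0 < L := Real.log_pos ((one_lt_div hr).2 hrR)
  have hlog4 : 0 < Real.log 4 := Real.log_pos (by norm_num)
  have hC0 : 0 ≤ C := by
    have := hC 2 1 (by linarith) (by norm_num) le_rfl
    rw [mul_one] at this
    exact (intervalIntegral.integral_nonneg (by norm_num) fun t _ ↦ by positivity).trans this
  refine ⟨(4 * C + 4 * Real.log 4) / (2 * δ * L), fun T hT S hS ↦ ?_⟩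
  have hT1 : -(T + 1) ≤ T + 1 := by linarith
  have hI := integral_circleAverage_dirichletEta_sq_le (T := T + 1) (C := C * (T + 1 + 2))
    hR hR' (by linarith)
    fun σ h1 h2 ↦ hC σ (T + 1 + 2) h1 h2 (by linarith)
  have hcontA : Continuous fun t : ℝ ↦
      Real.circleAverage (fun z ↦ ‖dirichletEta z‖ ^ 2) (2 + t * I) R := by
    simp only [Real.circleAverage, smul_eq_mul]
    exact continuous_const.mul
      (intervalIntegral.continuous_parametric_intervalIntegral_of_continuous'
        (f := fun t θ : ℝ ↦ ‖dirichletEta (circleMap (2 + t * I) R θ)‖ ^ 2)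
        (μ := volume) (continuous_norm_sq_dirichletEta_circleMap hR hR') _ _)
  have hpt (t : ℝ) : ∑ z ∈ S, (Set.Icc (z.im - δ) (z.im + δ)).indicator (fun _ ↦ L) t ≤
      Real.circleAverage (fun z ↦ ‖dirichletEta z‖ ^ 2) (2 + t * I) R + Real.log 4 := by
    have hball : Metric.closedBall (2 + t * I : ℂ) R ⊆ {s | 0 < s.re} := fun z hz ↦ by
      have h1 := (abs_re_le_norm (z - (2 + t * I))).trans (mem_closedBall_iff_norm.1 hz)
      simp only [sub_re, add_re, re_ofNat, mul_re, ofReal_re, I_re, mul_zero, ofReal_im, I_im,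
        mul_one, sub_self, add_zero] at h1
      rw [Set.mem_ofPred_eq]
      linarith [(abs_le.1 h1).1]
    have hana := analyticOnNhd_dirichletEta.mono hball
    have hge := norm_dirichletEta_two_add_ge t
    have hj := card_mul_log_add_log_norm_le_circleAverage hr hrR hana
      (norm_pos_iff.1 (by linarith)) (S.filter fun z ↦ t ∈ Set.Icc (z.im - δ) (z.im + δ))
      fun z hz ↦ by
        obtain ⟨hzS, hzt⟩ := Finset.mem_filter.1 hz
        obtain ⟨h0, h1, h2, -⟩ := hS z hzS
        refine ⟨h0, mem_closedBall_iff_norm.2 ((norm_le_abs_re_add_abs_im _).trans ?_)⟩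
        simp only [sub_re, add_re, re_ofNat, mul_re, ofReal_re, I_re, mul_zero, ofReal_im, I_im,
          mul_one, sub_self, add_zero, sub_im, add_im, im_ofNat, mul_im, zero_add]
        refine add_le_add (abs_le.2 ⟨by linarith, by linarith⟩)
          (abs_le.2 ⟨by linarith [hzt.2], by linarith [hzt.1]⟩)
    have hmono : Real.circleAverage (fun z ↦ Real.log ‖dirichletEta z‖) (2 + t * I) R ≤
        Real.circleAverage (fun z ↦ ‖dirichletEta z‖ ^ 2) (2 + t * I) R := by
      have hsub : Metric.sphere (2 + t * I : ℂ) |R| ⊆ Metric.closedBall (2 + t * I) R := by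
        rw [abs_of_pos (by linarith)]; exact Metric.sphere_subset_closedBall
      refine Real.circleAverage_mono
        ((hana.mono hsub).meromorphicOn.circleIntegrable_log_norm) ?_
        fun z _ ↦ Real.log_le_sq (norm_nonneg _)
      exact ContinuousOn.circleIntegrable' ((hana.mono hsub).continuousOn.norm.pow 2)
    have hlog : -Real.log 4 ≤ Real.log ‖dirichletEta (2 + t * I)‖ := by
      rw [← Real.log_inv]
      exact Real.log_le_log (by norm_num) (by linarith)
    have hcount : ∑ z ∈ S, (Set.Icc (z.im - δ) (z.im + δ)).indicator (fun _ ↦ L) t =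
        (S.filter fun z ↦ t ∈ Set.Icc (z.im - δ) (z.im + δ)).card * L := by
      rw [← nsmul_eq_mul, ← Finset.sum_const, Finset.sum_filter]
      simp only [Set.indicator_apply]
    linarith
  have hint (z : ℂ) : IntegrableOn
      ((Set.Icc (z.im - δ) (z.im + δ)).indicator fun _ ↦ L) (Set.Icc (-(T + 1)) (T + 1)) :=
    (integrableOn_const (by simp)).indicator measurableSet_Icc
  have hlow : ∫ t in Set.Icc (-(T + 1)) (T + 1),
      ∑ z ∈ S, (Set.Icc (z.im - δ) (z.im + δ)).indicator (fun _ ↦ L) t =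
      S.card * (2 * δ * L) := by
    rw [integral_finsetSum _ fun z _ ↦ hint z, ← nsmul_eq_mul, ← Finset.sum_const]
    refine Finset.sum_congr rfl fun z hz ↦ ?_
    have him := abs_le.1 (hS z hz).2.2.2
    rw [setIntegral_indicator measurableSet_Icc, Set.inter_eq_right.2
      (Set.Icc_subset_Icc (by linarith) (by linarith)), setIntegral_const, Measure.real,
      Real.volume_Icc, ENNReal.toReal_ofReal (by linarith), smul_eq_mul]
    ring
  have hcontB : Continuous fun t : ℝ ↦
      Real.circleAverage (fun z ↦ ‖dirichletEta z‖ ^ 2) (2 + t * I) R + Real.log 4 :=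
    hcontA.add continuous_const
  have hup := setIntegral_mono (μ := volume) (integrable_finsetSum S fun z _ ↦ hint z)
    hcontB.continuousOn.integrableOn_Icc hpt
  rw [hlow, integral_Icc_eq_integral_Ioc, ← intervalIntegral.integral_of_le hT1,
    intervalIntegral.integral_add (hcontA.intervalIntegrable _ _) intervalIntegrable_const,
    intervalIntegral.integral_const, smul_eq_mul] at hup
  rw [div_mul_eq_mul_div, le_div_iff₀ (by positivity)]
  nlinarith [mul_nonneg hC0 (sub_nonneg.2 hT), mul_nonneg hlog4.le (sub_nonneg.2 hT)]

/-- The zeros of `ζ` off the real axis with real part at least `σ` and height at most `T`. -/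
def zetaZerosRight (σ T : ℝ) : Set ℂ :=
  {z | riemannZeta z = 0 ∧ σ ≤ z.re ∧ z.im ≠ 0 ∧ |z.im| ≤ T}

/-- The Bohr–Landau zero-density bound for the Riemann zeta function. -/
theorem exists_ncard_zetaZerosRight_le {σ : ℝ} (hσ : 1 / 2 < σ) (hσ' : σ ≤ 1) :
    ∃ C : ℝ, ∀ T : ℝ, 1 ≤ T →
      (zetaZerosRight σ T).Finite ∧ (zetaZerosRight σ T).ncard ≤ C * T := by
  obtain ⟨C, hC⟩ := exists_card_dirichletEta_zeros_le hσ hσ'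
  refine ⟨C, fun T hT ↦ ?_⟩
  have hcard (S : Finset ℂ) (hS : (S : Set ℂ) ⊆ zetaZerosRight σ T) : S.card ≤ C * T := by
    refine hC T hT S fun z hz ↦ ?_
    obtain ⟨h0, hre, him, hT⟩ := hS hz
    refine ⟨?_, hre, ?_, hT⟩
    · rw [dirichletEta_eq_riemannZeta (by linarith) him, h0, mul_zero]
    · by_contra! h
      exact riemannZeta_ne_zero_of_one_le_re h.le h0
  have hfin : (zetaZerosRight σ T).Finite := by
    by_contra hinf
    obtain ⟨S, hS, hScard⟩ := Set.Infinite.exists_subset_card_eq hinf (⌊C * T⌋₊ + 1)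
    have := hcard S hS
    rw [hScard, Nat.cast_add_one] at this
    linarith [Nat.lt_floor_add_one (C * T)]
  refine ⟨hfin, ?_⟩
  rw [Set.ncard_eq_toFinset_card _ hfin]
  exact hcard _ (by simp)

lemma Set.finite_and_ncard_le_card_mul_ncard {α β ι : Type*} [Nonempty ι] (I : Finset ι)
    {f : ι → α → β} (hf : ∀ i ∈ I, Function.Injective (f i)) {A : Set α} {Z : Set β} (hZ : Z.Finite)
    (h : ∀ a ∈ A, ∃ i ∈ I, f i a ∈ Z) : A.Finite ∧ A.ncard ≤ I.card * Z.ncard := by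
  classical
  choose! i hiI hiZ using h
  have hmaps : ∀ a ∈ A, (i a, f (i a) a) ∈ (I : Set ι) ×ˢ Z := fun a ha ↦ ⟨hiI a ha, hiZ a ha⟩
  have hinj : Set.InjOn (fun a ↦ (i a, f (i a) a)) A := fun a ha b hb hab ↦ by
    obtain ⟨h1, h2⟩ := Prod.mk.inj hab
    rw [h1] at h2
    exact hf _ (hiI b hb) h2
  have hfin : ((I : Set ι) ×ˢ Z).Finite := I.finite_toSet.prod hZ
  refine ⟨Set.Finite.of_injOn hmaps hinj hfin, ?_⟩
  calc A.ncard ≤ ((I : Set ι) ×ˢ Z).ncard := Set.ncard_le_ncard_of_injOn _ hmaps hinj hfin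
    _ = I.card * Z.ncard := by rw [Set.ncard_prod, Set.ncard_coe_finset]

lemma riemannZeta_one_sub_eq_zero {s : ℂ} (hs : riemannZeta s = 0) (him : s.im ≠ 0) :
    riemannZeta (1 - s) = 0 := by
  rw [riemannZeta_one_sub (fun n h ↦ him (by simp [h])) (fun h ↦ him (by simp [h])), hs, mul_zero]

lemma natCast_mul_div_natCast_re (j ℓ : ℕ) (w : ℂ) : ((j : ℂ) * w / ℓ).re = j * w.re / ℓ := by
  rw [div_natCast_re, ← nsmul_eq_mul, smul_re, nsmul_eq_mul]

lemma natCast_mul_div_natCast_im (j ℓ : ℕ) (w : ℂ) : ((j : ℂ) * w / ℓ).im = j * w.im / ℓ := by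
  rw [div_natCast_im, ← nsmul_eq_mul, smul_im, nsmul_eq_mul]

lemma mem_or_one_sub_mem_zetaZerosRight {ℓ j : ℕ} {T : ℝ} {w : ℂ} (hℓ : 1 ≤ ℓ) (hj : 1 ≤ j)
    (hj' : j ≤ 2 * ℓ) (him : w.im ≠ 0) (hT : |w.im| ≤ T)
    (hζ : riemannZeta ((j : ℂ) * w / ℓ) = 0)
    (hre : j < ℓ → w.re ≤ (ℓ + 1 : ℝ) / (2 * ℓ + 1)) (hre' : ℓ < j → (ℓ : ℝ) / (2 * ℓ + 1) ≤ w.re)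
    (hre'' : j = ℓ → (ℓ + 1 : ℝ) / (2 * ℓ + 1) ≤ w.re) :
    (j : ℂ) * w / ℓ ∈ zetaZerosRight ((ℓ + 1 : ℝ) / (2 * ℓ + 1)) (2 * T) ∨
      1 - (j : ℂ) * w / ℓ ∈ zetaZerosRight ((ℓ + 1 : ℝ) / (2 * ℓ + 1)) (2 * T) := by
  have hℓ0 : (1 : ℝ) ≤ ℓ := by exact_mod_cast hℓ
  have hj0 : (1 : ℝ) ≤ j := by exact_mod_cast hj
  have hj2 : (j : ℝ) ≤ 2 * ℓ := by exact_mod_cast hj'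
  have him1 : ((j : ℂ) * w / ℓ).im ≠ 0 := by
    rw [natCast_mul_div_natCast_im]
    positivity
  have him2 : |((j : ℂ) * w / ℓ).im| ≤ 2 * T := by
    rw [natCast_mul_div_natCast_im, abs_div, abs_mul, Nat.abs_cast, Nat.abs_cast,
      div_le_iff₀ (by positivity)]
    nlinarith [abs_nonneg w.im]
  rcases lt_trichotomy j ℓ with h | h | h
  · right
    have hjℓ : (j : ℝ) + 1 ≤ ℓ := by exact_mod_cast h
    refine ⟨riemannZeta_one_sub_eq_zero hζ him1, ?_, by simpa using him1, by simpa using him2⟩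
    have h1 := (le_div_iff₀ (by positivity)).1 (hre h)
    rw [sub_re, one_re, natCast_mul_div_natCast_re, le_sub_iff_add_le, div_add_div _ _
      (by positivity) (by positivity), div_le_one (by positivity)]
    nlinarith [mul_le_mul_of_nonneg_left h1 (by positivity : (0 : ℝ) ≤ j)]
  · left
    subst h
    refine ⟨hζ, ?_, him1, him2⟩
    rw [natCast_mul_div_natCast_re, mul_div_cancel_left₀ _ (by positivity)]
    exact hre'' rfl
  · left
    have hjℓ : (ℓ : ℝ) + 1 ≤ j := by exact_mod_cast h
    refine ⟨hζ, ?_, him1, him2⟩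
    have h1 := (div_le_iff₀ (by positivity)).1 (hre' h)
    rw [natCast_mul_div_natCast_re, div_le_div_iff₀ (by positivity) (by positivity)]
    have hw : 0 ≤ w.re := le_trans (by positivity) (hre' h)
    nlinarith [mul_le_mul_of_nonneg_right hjℓ (by positivity : (0 : ℝ) ≤ w.re * (2 * ℓ + 1)),
      mul_le_mul_of_nonneg_left h1 (by positivity : (0 : ℝ) ≤ ℓ + 1)]

/-- The maps `ρ ↦ jw/ℓ` and `ρ ↦ 1 - jw/ℓ` with `w = ρ` or `w = 1 - ρ`. -/
noncomputable def scaledReflection (ℓ : ℕ) (i : ℕ × Bool × Bool) (ρ : ℂ) : ℂ :=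
  let u := (i.1 : ℂ) * (bif i.2.1 then 1 - ρ else ρ) / ℓ
  bif i.2.2 then 1 - u else u

lemma scaledReflection_injective {ℓ : ℕ} (hℓ : ℓ ≠ 0) {i : ℕ × Bool × Bool} (hi : i.1 ≠ 0) :
    Function.Injective (scaledReflection ℓ i) := by
  obtain ⟨j, b, b'⟩ := i
  have hj : (j : ℂ) ≠ 0 := by exact_mod_cast hi
  have hℓ' : (ℓ : ℂ) ≠ 0 := by exact_mod_cast hℓ
  intro x y hxy
  cases b <;> cases b' <;> simpa [scaledReflection, hj, hℓ', div_left_inj'] using hxy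

lemma exists_scaledReflection_mem_zetaZerosRight {ℓ j : ℕ} {T : ℝ} {ρ : ℂ} {b : Bool}
    (hj : j ∈ Finset.Icc 1 (2 * ℓ))
    (h : (j : ℂ) * (bif b then 1 - ρ else ρ) / ℓ ∈
        zetaZerosRight ((ℓ + 1 : ℝ) / (2 * ℓ + 1)) (2 * T) ∨
      1 - (j : ℂ) * (bif b then 1 - ρ else ρ) / ℓ ∈
        zetaZerosRight ((ℓ + 1 : ℝ) / (2 * ℓ + 1)) (2 * T)) :
    ∃ i ∈ Finset.Icc 1 (2 * ℓ) ×ˢ (Finset.univ : Finset (Bool × Bool)),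
      scaledReflection ℓ i ρ ∈ zetaZerosRight ((ℓ + 1 : ℝ) / (2 * ℓ + 1)) (2 * T) := by
  rcases h with h | h
  · exact ⟨(j, b, false), by simpa using hj, h⟩
  · exact ⟨(j, b, true), by simpa using hj, h⟩

/-- The nontrivial zeros `ρ` of `ζ` with `0 < Im ρ ≤ T` that fail one of the two conditions. -/
def excludedZeros (ℓ : ℕ) (T : ℝ) : Set ℂ :=
  {ρ | riemannZeta ρ = 0 ∧ 0 < ρ.re ∧ ρ.re < 1 ∧ 0 < ρ.im ∧ ρ.im ≤ T ∧
    ¬(((ℓ : ℝ) / (2 * ℓ + 1) < ρ.re ∧ ρ.re < ((ℓ : ℝ) + 1) / (2 * ℓ + 1)) ∧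
      ∀ j : ℕ, 1 ≤ j → j ≤ 2 * ℓ → j ≠ ℓ →
        riemannZeta ((j : ℂ) * ρ / (ℓ : ℂ)) ≠ 0 ∧
        riemannZeta ((j : ℂ) * (1 - ρ) / (ℓ : ℂ)) ≠ 0)}

lemma exists_scaledReflection_mem_of_mem_excludedZeros {ℓ : ℕ} (hℓ : 1 ≤ ℓ) {T : ℝ} {ρ : ℂ}
    (hρ : ρ ∈ excludedZeros ℓ T) :
    ∃ i ∈ Finset.Icc 1 (2 * ℓ) ×ˢ (Finset.univ : Finset (Bool × Bool)),
      scaledReflection ℓ i ρ ∈ zetaZerosRight ((ℓ + 1 : ℝ) / (2 * ℓ + 1)) (2 * T) := by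
  have hℓ1 : (ℓ : ℂ) ≠ 0 := by exact_mod_cast (by omega : ℓ ≠ 0)
  have hsum : (ℓ : ℝ) / (2 * ℓ + 1) = 1 - ((ℓ : ℝ) + 1) / (2 * ℓ + 1) := by
    field_simp
    ring
  obtain ⟨h0, -, -, him, hT, hbad⟩ := hρ
  have hT' : |ρ.im| ≤ T := by rwa [abs_of_pos him]
  have him' : (1 - ρ).im ≠ 0 := by simpa using him.ne'
  have hT'' : |(1 - ρ).im| ≤ T := by simpa using hT'
  have h0' := riemannZeta_one_sub_eq_zero h0 him.ne'
  by_cases hre : (ℓ : ℝ) / (2 * ℓ + 1) < ρ.re ∧ ρ.re < ((ℓ : ℝ) + 1) / (2 * ℓ + 1)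
  · simp only [hre, true_and, not_forall, not_and_or, not_not] at hbad
    obtain ⟨j, hj1, hj2, hjℓ, h | h⟩ := hbad
    · exact exists_scaledReflection_mem_zetaZerosRight (b := false) (Finset.mem_Icc.2 ⟨hj1, hj2⟩)
        (mem_or_one_sub_mem_zetaZerosRight hℓ hj1 hj2 him.ne' hT' h (fun _ ↦ hre.2.le)
          (fun _ ↦ hre.1.le) fun h ↦ absurd h hjℓ)
    · refine exists_scaledReflection_mem_zetaZerosRight (b := true) (Finset.mem_Icc.2 ⟨hj1, hj2⟩)
        (mem_or_one_sub_mem_zetaZerosRight hℓ hj1 hj2 him' hT'' h (fun _ ↦ ?_)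
          (fun _ ↦ ?_) fun h ↦ absurd h hjℓ)
      · rw [cond_true, sub_re, one_re]
        linarith [hre.1]
      · rw [cond_true, sub_re, one_re]
        linarith [hre.2]
  · have hℓmem : ℓ ∈ Finset.Icc 1 (2 * ℓ) := Finset.mem_Icc.2 ⟨hℓ, by omega⟩
    rcases not_and_or.1 hre with h | h
    · refine exists_scaledReflection_mem_zetaZerosRight (b := true) hℓmem
        (mem_or_one_sub_mem_zetaZerosRight hℓ hℓ (by omega) him' hT'' ?_ (by simp) (by simp)
          fun _ ↦ ?_)
      · rwa [mul_div_cancel_left₀ _ hℓ1]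
      · rw [cond_true, sub_re, one_re]
        linarith
    · refine exists_scaledReflection_mem_zetaZerosRight (b := false) hℓmem
        (mem_or_one_sub_mem_zetaZerosRight hℓ hℓ (by omega) him.ne' hT' ?_ (by simp) (by simp)
          fun _ ↦ not_lt.1 h)
      rwa [mul_div_cancel_left₀ _ hℓ1]

/-- counting excluded zeros.
For every integer `ℓ ≥ 1` there is a constant `C` such that for all `T ≥ 3`,
the number of distinct nontrivial zeros `ρ = β + iγ` of `ζ` with `0 < γ ≤ T`
that fail (i) `ℓ/(2ℓ+1) < β < (ℓ+1)/(2ℓ+1)`, or (ii) `ζ(jρ/ℓ) ≠ 0` and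
`ζ(j(1-ρ)/ℓ) ≠ 0` for every `1 ≤ j ≤ 2ℓ` with `j ≠ ℓ`, is at most `C·T`. -/
theorem stmt_5 (ℓ : ℕ) (hℓ : 1 ≤ ℓ) :
    ∃ C : ℝ, ∀ T : ℝ, 3 ≤ T →
      ∃ S : Finset ℂ,
        (∀ ρ : ℂ, ρ ∈ S ↔
          (riemannZeta ρ = 0 ∧ 0 < ρ.re ∧ ρ.re < 1 ∧ 0 < ρ.im ∧ ρ.im ≤ T ∧
            ¬(((ℓ : ℝ) / (2 * ℓ + 1) < ρ.re ∧ ρ.re < ((ℓ : ℝ) + 1) / (2 * ℓ + 1)) ∧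
              ∀ j : ℕ, 1 ≤ j → j ≤ 2 * ℓ → j ≠ ℓ →
                riemannZeta ((j : ℂ) * ρ / (ℓ : ℂ)) ≠ 0 ∧
                riemannZeta ((j : ℂ) * (1 - ρ) / (ℓ : ℂ)) ≠ 0))) ∧
        (S.card : ℝ) ≤ C * T := by
  have hℓ0 : (1 : ℝ) ≤ ℓ := by exact_mod_cast hℓ
  obtain ⟨C, hC⟩ := exists_ncard_zetaZerosRight_le (σ := ((ℓ : ℝ) + 1) / (2 * ℓ + 1))
    (by rw [div_lt_div_iff₀ (by norm_num) (by positivity)]; linarith)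
    (by rw [div_le_one (by positivity)]; linarith)
  set I := Finset.Icc 1 (2 * ℓ) ×ˢ (Finset.univ : Finset (Bool × Bool))
  refine ⟨I.card * (C * 2), fun T hT ↦ ?_⟩
  obtain ⟨hfin, hcard⟩ := hC (2 * T) (by linarith)
  obtain ⟨hAfin, hAcard⟩ := Set.finite_and_ncard_le_card_mul_ncard I
    (fun i hi ↦ scaledReflection_injective (by omega)
      (by have := (Finset.mem_Icc.1 (Finset.mem_product.1 hi).1).1; omega)) hfin
    fun _ ↦ exists_scaledReflection_mem_of_mem_excludedZeros (T := T) hℓ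
  refine ⟨hAfin.toFinset, fun ρ ↦ by rw [Set.Finite.mem_toFinset]; rfl, ?_⟩
  rw [← Set.ncard_eq_toFinset_card _ hAfin]
  refine (Nat.cast_le.2 hAcard).trans ?_
  rw [Nat.cast_mul]
  linarith [mul_le_mul_of_nonneg_left hcard (Nat.cast_nonneg I.card)]
end
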